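/- Let n ≥ 2 be an integer and f(s) = s^p − s^q with p > q > 0. Assume one of the following holds: (i) n > 2, 0 < q ≤ 4/(n−2) and q < p ≤ (n+2)/(n−2); (ii) n > 2, 4/(n−2) < q < (4 + √(2n(n+2)))/(2(n−2)) and q < p ≤ P(q), where P(q) = (2(q+1) + √((n+2)(q+1)(n+2−(n−2)q)))/n; (iii) n = 2 and 0 < q < p. Then for every a ∈ (0,∞), the exterior problem (R) with b = ∞ has at most one positive solution. -/

import Mathlib

open Set Filter MeasureTheory

/-- `F(s) = ∫₀ˢ f(t) dt`. -/
noncomputable def Fint (f : ℝ → ℝ) (s : ℝ) : ℝ := ∫ t in (0:ℝ)..s, f t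

/-- Condition (f1): `f` is continuous on `[0,∞)`, continuously differentiable on `(0,∞)`,
and `f' ∈ L¹(0,1)`. -/
def CondF1 (f : ℝ → ℝ) : Prop :=
  ContinuousOn f (Ici 0) ∧ (∀ s ∈ Ioi (0:ℝ), DifferentiableAt ℝ f s) ∧
  ContinuousOn (deriv f) (Ioi 0) ∧ IntervalIntegrable (deriv f) volume 0 1

/-- Condition (f2) in the case `β > B > 0`. -/
def CondF2B (f : ℝ → ℝ) (β B : ℝ) : Prop :=
  f 0 = 0 ∧ 0 < B ∧ B < β ∧ (∀ s, B < s → 0 < f s) ∧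
  (∀ s ∈ Icc (0:ℝ) B, f s ≤ 0) ∧ (∃ ε > (0:ℝ), ∀ s ∈ Ioo (0:ℝ) ε, f s < 0) ∧
  Fint f β = 0

/-- Condition (f2): either `β = B = 0` and `f > 0` on `(0,∞)`, or `β > B > 0` with the
sign conditions and `F(β) = 0`. -/
def CondF2 (f : ℝ → ℝ) (β B : ℝ) : Prop :=
  (β = 0 ∧ B = 0 ∧ f 0 = 0 ∧ ∀ s, 0 < s → 0 < f s) ∨ CondF2B f β B

/-- Condition (f3): the derivative of `s ↦ F(s)/f(s)` is `≥ (n-2)/(2n)` for every `s > β`. -/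
def CondF3 (n : ℕ) (f : ℝ → ℝ) (β : ℝ) : Prop :=
  ∀ s, β < s → ∃ d, ((n : ℝ) - 2) / (2 * (n : ℝ)) ≤ d ∧
    HasDerivAt (fun t => Fint f t / f t) d s

/-- Condition (f4): superlinearity `f(s) ≤ f'(s)(s - B)` for `s > B`, with
`f(s) ≢ f'(s)(s - B)` on `[B, β]`. -/
def CondF4 (f : ℝ → ℝ) (β B : ℝ) : Prop :=
  (∀ s, B < s → f s ≤ deriv f s * (s - B)) ∧
  ¬ (∀ s ∈ Icc B β, f s = deriv f s * (s - B))

/-- A positive solution of problem (R) on the annulus `a < |x| < b`: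
`u` is continuous on `[a,b]`, differentiable up to the boundary with derivative `u'`
(one-sided at the endpoints), `u'` is continuous on `[a,b]`, `u` is twice continuously
differentiable on `(a,b)` where it satisfies `u'' + ((n-1)/r) u' + f(u) = 0`,
`u(a) = u(b) = 0` and `u > 0` on `(a,b)`. -/
def IsPosSolAnn (n : ℕ) (a b : ℝ) (f u u' : ℝ → ℝ) : Prop :=
  ContinuousOn u (Icc a b) ∧
  (∀ r ∈ Icc a b, HasDerivWithinAt u (u' r) (Icc a b) r) ∧
  ContinuousOn u' (Icc a b) ∧
  (∀ r ∈ Ioo a b, HasDerivAt u (u' r) r) ∧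
  (∀ r ∈ Ioo a b, HasDerivAt u' (-(((n : ℝ) - 1) / r * u' r + f (u r))) r) ∧
  u a = 0 ∧ u b = 0 ∧ (∀ r ∈ Ioo a b, 0 < u r)

/-- A positive solution of the exterior problem (R) with `b = ∞`:
`u` is continuous on `[a,∞)`, differentiable on `[a,∞)` with derivative `u'`
(one-sided at `a`), twice continuously differentiable on `(a,∞)` where it satisfies
`u'' + ((n-1)/r) u' + f(u) = 0`, `u(a) = 0`, `u > 0` on `(a,∞)` and `u(r) → 0` as `r → ∞`. -/
def IsPosSolExt (n : ℕ) (a : ℝ) (f u u' : ℝ → ℝ) : Prop :=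
  ContinuousOn u (Ici a) ∧
  (∀ r ∈ Ici a, HasDerivWithinAt u (u' r) (Ici a) r) ∧
  (∀ r ∈ Ioi a, HasDerivAt u (u' r) r) ∧
  (∀ r ∈ Ioi a, HasDerivAt u' (-(((n : ℝ) - 1) / r * u' r + f (u r))) r) ∧
  u a = 0 ∧ (∀ r ∈ Ioi a, 0 < u r) ∧
  Tendsto u atTop (nhds 0)

/-- The Erbe–Tang functional
`P(s) = -2n (F(s)/f(s)) ρ(s)^{n-1} u'(ρ(s)) - ρ(s)^n (u'(ρ(s)))² - 2 ρ(s)^n F(s)`,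
where `ρ` is an inverse branch of the solution `u` with derivative `u'`. -/
noncomputable def Pfun (n : ℕ) (f : ℝ → ℝ) (ρ u' : ℝ → ℝ) (s : ℝ) : ℝ :=
  -2 * (n : ℝ) * (Fint f s / f s) * (ρ s) ^ (n - 1) * u' (ρ s)
    - (ρ s) ^ n * (u' (ρ s)) ^ 2 - 2 * (ρ s) ^ n * Fint f s

section partA
lemma ax_mono {g g' : ℝ → ℝ} {a b : ℝ} (hab : a ≤ b) (hc : ContinuousOn g (Icc a b))
    (hd : ∀ x ∈ Ioo a b, HasDerivAt g (g' x) x) (h : ∀ x ∈ Ioo a b, 0 ≤ g' x) : g a ≤ g b := by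
  have : MonotoneOn g (Icc a b) := by
    apply monotoneOn_of_deriv_nonneg (convex_Icc a b) hc
    · rw [interior_Icc]; exact fun x hx => (hd x hx).differentiableAt.differentiableWithinAt
    · rw [interior_Icc]; intro x hx; rw [(hd x hx).deriv]; exact h x hx
  exact this (left_mem_Icc.2 hab) (right_mem_Icc.2 hab) hab

lemma ax_smono {g g' : ℝ → ℝ} {a b : ℝ} (hab : a < b) (hc : ContinuousOn g (Icc a b))
    (hd : ∀ x ∈ Ioo a b, HasDerivAt g (g' x) x) (h : ∀ x ∈ Ioo a b, 0 < g' x) : g a < g b := by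
  have : StrictMonoOn g (Icc a b) := by
    apply strictMonoOn_of_deriv_pos (convex_Icc a b) hc
    rw [interior_Icc]; intro x hx; rw [(hd x hx).deriv]; exact h x hx
  exact this (left_mem_Icc.2 hab.le) (right_mem_Icc.2 hab.le) hab

lemma ax_anti {g g' : ℝ → ℝ} {a b : ℝ} (hab : a ≤ b) (hc : ContinuousOn g (Icc a b))
    (hd : ∀ x ∈ Ioo a b, HasDerivAt g (g' x) x) (h : ∀ x ∈ Ioo a b, g' x ≤ 0) : g b ≤ g a := by
  have := ax_mono (g := fun x => - g x) (g' := fun x => - g' x) hab hc.neg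
    (fun x hx => (hd x hx).neg) (fun x hx => by have := h x hx; simp; linarith)
  simp at this; exact this

lemma ax_santi {g g' : ℝ → ℝ} {a b : ℝ} (hab : a < b) (hc : ContinuousOn g (Icc a b))
    (hd : ∀ x ∈ Ioo a b, HasDerivAt g (g' x) x) (h : ∀ x ∈ Ioo a b, g' x < 0) : g b < g a := by
  have := ax_smono (g := fun x => - g x) (g' := fun x => - g' x) hab hc.neg
    (fun x hx => (hd x hx).neg) (fun x hx => by have := h x hx; simp; linarith)
  simp at this; exact this

/-- first failure principle, moving to the right -/
lemma ff_up {g : ℝ → ℝ} {a b : ℝ} (hc : ContinuousOn g (Icc a b)) (h0 : 0 < g a)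
    (step : ∀ c ∈ Ioc a b, (∀ x ∈ Ico a c, 0 < g x) → 0 < g c) : ∀ x ∈ Icc a b, 0 < g x := by
  intro x hx
  by_contra hneg
  push Not at hneg
  set Z : Set ℝ := Icc a b ∩ g ⁻¹' (Iic 0) with hZ
  have hZc : IsClosed Z := hc.preimage_isClosed_of_isClosed isClosed_Icc isClosed_Iic
  have hZn : Z.Nonempty := ⟨x, hx, hneg⟩
  have hZb : BddBelow Z := ⟨a, fun y hy => hy.1.1⟩
  have hm := hZc.csInf_mem hZn hZb
  set c := sInf Z
  have hca : a < c := by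
    rcases eq_or_lt_of_le hm.1.1 with h | h
    · have h2 : g c ≤ 0 := hm.2
      rw [← h] at h2; linarith
    · exact h
  have := step c ⟨hca, hm.1.2⟩ (by
    intro y hy
    by_contra hy0
    push Not at hy0
    have : c ≤ y := csInf_le hZb ⟨⟨hy.1, hy.2.le.trans hm.1.2⟩, hy0⟩
    linarith [hy.2])
  have h2 : g c ≤ 0 := hm.2
  linarith

/-- first failure principle, moving to the left -/
lemma ff_dn {g : ℝ → ℝ} {a b : ℝ} (hc : ContinuousOn g (Icc a b)) (h0 : 0 < g b)
    (step : ∀ c ∈ Ico a b, (∀ x ∈ Ioc c b, 0 < g x) → 0 < g c) : ∀ x ∈ Icc a b, 0 < g x := by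
  have := ff_up (g := fun x => g (-x)) (a := -b) (b := -a)
    (hc.comp continuous_neg.continuousOn (fun x hx => ⟨by linarith [hx.2], by linarith [hx.1]⟩))
    (by simpa using h0)
    (fun c hc h => step (-c) ⟨by linarith [hc.2], by linarith [hc.1]⟩ (fun x hx => by
      simpa using h (-x) ⟨by linarith [hx.2], by linarith [hx.1]⟩))
  intro x hx
  simpa using this (-x) ⟨by linarith [hx.2], by linarith [hx.1]⟩

/-- abstract nonlinearity -/
structure Nl (k : ℕ) (f F m' : ℝ → ℝ) (β : ℝ) : Prop where
  hk : 1 ≤ k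
  hβ : 1 < β
  contF : ContinuousOn F (Ici 0)
  contf : ContinuousOn f (Ici 0)
  dF : ∀ s, 0 < s → HasDerivAt F (f s) s
  F0 : F 0 = 0
  Fβ : F β = 0
  Fneg : ∀ s ∈ Icc 0 β, F s ≤ 0
  Fpos : ∀ s, β < s → 0 < F s
  fpos : ∀ s, β ≤ s → 0 < f s
  dm : ∀ s, β < s → HasDerivAt (fun t => F t / f t) (m' s) s
  hG : ∀ s, β < s → (k : ℝ) - 1 ≤ 2 * ((k : ℝ) + 1) * m' s

/-- the increasing branch, in the variable `s = u` -/
structure UpBr (k : ℕ) (f F : ℝ → ℝ) (a M T : ℝ) (τ V : ℝ → ℝ) : Prop where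
  ha : 0 < a
  cτ : ContinuousOn τ (Icc 0 M)
  cV : ContinuousOn V (Icc 0 M)
  τ0 : τ 0 = a
  τM : τ M = T
  VM : V M = 0
  Vpos : ∀ s ∈ Ico 0 M, 0 < V s
  τge : ∀ s ∈ Icc 0 M, a ≤ τ s
  dτ : ∀ s ∈ Ioo 0 M, HasDerivAt τ (1 / V s) s
  dV : ∀ s ∈ Ioo 0 M, HasDerivAt V (-((k : ℝ) / τ s) - f s / V s) s
  E : ∀ s ∈ Icc 0 M, 0 < V s ^ 2 + 2 * F s

/-- the decreasing branch, in the variable `s = u`; `v = -u'`. -/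
structure DnBr (k : ℕ) (f F : ℝ → ℝ) (M T : ℝ) (ρ v : ℝ → ℝ) : Prop where
  hT : 0 < T
  cρ : ContinuousOn ρ (Ioc 0 M)
  cv : ContinuousOn v (Ioc 0 M)
  ρM : ρ M = T
  vM : v M = 0
  vpos : ∀ s ∈ Ioo 0 M, 0 < v s
  ρge : ∀ s ∈ Ioc 0 M, T ≤ ρ s
  dρ : ∀ s ∈ Ioo 0 M, HasDerivAt ρ (-(1 / v s)) s
  dv : ∀ s ∈ Ioo 0 M, HasDerivAt v ((k : ℝ) / ρ s - f s / v s) s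
  E : ∀ s ∈ Ioc 0 M, 0 < v s ^ 2 + 2 * F s
  lim : Tendsto ρ (nhdsWithin 0 (Ioi 0)) atTop

end partA

section partB
lemma pow_der {g : ℝ → ℝ} {g' x : ℝ} (m : ℕ) (h : HasDerivAt g g' x) (hx : g x ≠ 0) :
    HasDerivAt (fun t => g t ^ m) ((m : ℝ) * g x ^ m / g x * g') x := by
  have := h.pow m
  refine this.congr_deriv ?_
  rcases m with _ | m
  · simp
  · simp only [Nat.add_sub_cancel]
    rw [pow_succ]; field_simp

section up
variable {k : ℕ} {f F m' : ℝ → ℝ} {β a M T : ℝ} {τ V : ℝ → ℝ}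

lemma UpBr.τpos (h : UpBr k f F a M T τ V) {s : ℝ} (hs : s ∈ Icc 0 M) : 0 < τ s :=
  lt_of_lt_of_le h.ha (h.τge s hs)

lemma UpBr.dZ (h : UpBr k f F a M T τ V) (N : Nl k f F m' β) {s : ℝ} (hs : s ∈ Ioo 0 M) :
    HasDerivAt (fun t => τ t ^ (2 * k) * (V t ^ 2 + 2 * F t))
      (4 * k * F s * (τ s ^ (2 * k) / τ s / V s)) s := by
  have h1 := h.τpos ⟨hs.1.le, hs.2.le⟩
  have h2 := h.Vpos s ⟨hs.1.le, hs.2⟩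
  have := (pow_der (2 * k) (h.dτ s hs) h1.ne').mul
    (((h.dV s hs).pow 2).add ((N.dF s hs.1).const_mul 2))
  refine this.congr_deriv ?_
  simp
  field_simp
  ring

lemma UpBr.dY (h : UpBr k f F a M T τ V) {s : ℝ} (hs : s ∈ Ioo 0 M) :
    HasDerivAt (fun t => τ t ^ (2 * k) * (V t ^ 2))
      (-(2 * f s * τ s ^ (2 * k))) s := by
  have h1 := h.τpos ⟨hs.1.le, hs.2.le⟩
  have h2 := h.Vpos s ⟨hs.1.le, hs.2⟩
  have := (pow_der (2 * k) (h.dτ s hs) h1.ne').mul ((h.dV s hs).pow 2)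
  refine this.congr_deriv ?_
  simp
  field_simp
  ring

/-- Erbe–Tang functional on a curve -/
lemma UpBr.dP (h : UpBr k f F a M T τ V) (N : Nl k f F m' β) {s : ℝ} (hs : s ∈ Ioo β M) :
    HasDerivAt (fun t => -2 * ((k : ℝ) + 1) * (F t / f t) * (τ t ^ k * V t)
        - τ t ^ (k + 1) * (V t ^ 2 + 2 * F t))
      (-((2 * ((k : ℝ) + 1) * m' s - (k - 1)) * (τ s ^ k * V s))) s := by
  have h0 : 0 < s := by linarith [N.hβ, hs.1]
  have h1 := h.τpos ⟨h0.le, hs.2.le⟩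
  have h2 := h.Vpos s ⟨h0.le, hs.2⟩
  have h3 := N.fpos s hs.1.le
  have hs' : s ∈ Ioo 0 M := ⟨h0, hs.2⟩
  have := (((N.dm s hs.1).const_mul (-2 * ((k : ℝ) + 1))).mul
      ((pow_der k (h.dτ s hs') h1.ne').mul (h.dV s hs'))).sub
    ((pow_der (k + 1) (h.dτ s hs') h1.ne').mul
    (((h.dV s hs').pow 2).add ((N.dF s hs'.1).const_mul 2)))
  refine this.congr_deriv ?_
  simp
  field_simp
  ring

lemma UpBr.cP (h : UpBr k f F a M T τ V) (N : Nl k f F m' β) :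
    ContinuousOn (fun t => -2 * ((k : ℝ) + 1) * (F t / f t) * (τ t ^ k * V t)
        - τ t ^ (k + 1) * (V t ^ 2 + 2 * F t)) (Icc β M) := by
  have hsub : Icc β M ⊆ Icc 0 M := Icc_subset_Icc_left (by linarith [N.hβ])
  have hsub2 : Icc β M ⊆ Ici 0 := fun x hx => le_trans (by linarith [N.hβ]) hx.1
  have c1 := h.cτ.mono hsub
  have c2 := h.cV.mono hsub
  have c3 := N.contF.mono hsub2
  have c4 := N.contf.mono hsub2
  have c5 : ContinuousOn (fun t => F t / f t) (Icc β M) :=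
    c3.div c4 (fun x hx => (N.fpos x hx.1).ne')
  fun_prop

end up

section up2
variable {k : ℕ} {f F m' : ℝ → ℝ} {β a M₁ T₁ M₂ T₂ : ℝ} {τ₁ V₁ τ₂ V₂ : ℝ → ℝ}

lemma up_tau (h₁ : UpBr k f F a M₁ T₁ τ₁ V₁) (h₂ : UpBr k f F a M₂ T₂ τ₂ V₂)
    {c : ℝ} (hc0 : 0 < c) (hc1 : c ≤ M₁) (hc2 : c ≤ M₂)
    (hV : ∀ x ∈ Ico 0 c, 0 < V₂ x - V₁ x) : τ₂ c < τ₁ c := by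
  have := ax_smono (g := fun s => τ₁ s - τ₂ s) (g' := fun s => 1 / V₁ s - 1 / V₂ s) hc0
    ((h₁.cτ.mono (Icc_subset_Icc_right hc1)).sub (h₂.cτ.mono (Icc_subset_Icc_right hc2)))
    (fun x hx => (h₁.dτ x ⟨hx.1, hx.2.trans_le hc1⟩).sub (h₂.dτ x ⟨hx.1, hx.2.trans_le hc2⟩))
    (fun x hx => by
      have e1 := h₁.Vpos x ⟨hx.1.le, hx.2.trans_le hc1⟩
      have e2 := hV x ⟨hx.1.le, hx.2⟩
      have := one_div_lt_one_div_of_lt e1 (by linarith : V₁ x < V₂ x)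
      linarith)
  simp only [h₁.τ0, h₂.τ0] at this
  linarith

/-- comparison of the Z functional, below `β` -/
lemma up_Z (N : Nl k f F m' β) (h₁ : UpBr k f F a M₁ T₁ τ₁ V₁) (h₂ : UpBr k f F a M₂ T₂ τ₂ V₂)
    (h0 : V₁ 0 < V₂ 0) {c : ℝ} (hc0 : 0 < c) (hc1 : c ≤ M₁) (hc2 : c ≤ M₂) (hcβ : c ≤ β)
    (hV : ∀ x ∈ Ico 0 c, 0 < V₂ x - V₁ x) :
    τ₁ c ^ (2 * k) * (V₁ c ^ 2 + 2 * F c) < τ₂ c ^ (2 * k) * (V₂ c ^ 2 + 2 * F c) := by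
  have hcont : ∀ {M T τ V}, UpBr k f F a M T τ V → c ≤ M →
      ContinuousOn (fun t => τ t ^ (2 * k) * (V t ^ 2 + 2 * F t)) (Icc 0 c) := by
    intro M T τ V h hc
    have c1 := h.cτ.mono (Icc_subset_Icc_right hc)
    have c2 := h.cV.mono (Icc_subset_Icc_right hc)
    have c3 := N.contF.mono (fun x hx => hx.1 : Icc 0 c ⊆ Ici 0)
    fun_prop
  have := ax_mono (g := fun s => τ₂ s ^ (2 * k) * (V₂ s ^ 2 + 2 * F s) -
      τ₁ s ^ (2 * k) * (V₁ s ^ 2 + 2 * F s))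
    (g' := fun s => (4 * k * F s * (τ₂ s ^ (2 * k) / τ₂ s / V₂ s)) -
      (4 * k * F s * (τ₁ s ^ (2 * k) / τ₁ s / V₁ s))) hc0.le
    ((hcont h₂ hc2).sub (hcont h₁ hc1))
    (fun x hx => (h₂.dZ N ⟨hx.1, hx.2.trans_le hc2⟩).sub (h₁.dZ N ⟨hx.1, hx.2.trans_le hc1⟩))
    (fun x hx => by
      have e1 := h₁.Vpos x ⟨hx.1.le, hx.2.trans_le hc1⟩
      have e2 := hV x ⟨hx.1.le, hx.2⟩
      have e3 : 0 < τ₂ x := h₂.τpos ⟨hx.1.le, (hx.2.trans_le hc2).le⟩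
      have e4 : τ₂ x < τ₁ x := up_tau h₁ h₂ hx.1 (hx.2.trans_le hc1).le (hx.2.trans_le hc2).le
        (fun y hy => hV y ⟨hy.1, hy.2.trans hx.2⟩)
      have e5 : F x ≤ 0 := N.Fneg x ⟨hx.1.le, hx.2.le.trans hcβ⟩
      have hk := N.hk
      have e6 : τ₂ x ^ (2 * k) / τ₂ x / V₂ x ≤ τ₁ x ^ (2 * k) / τ₁ x / V₁ x := by
        have q1 : τ₂ x ^ (2 * k) / τ₂ x = τ₂ x ^ (2 * k - 1) := by
          rw [← pow_sub_one_mul (by lia : 2 * k ≠ 0)]; field_simp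
        have q2 : τ₁ x ^ (2 * k) / τ₁ x = τ₁ x ^ (2 * k - 1) := by
          rw [← pow_sub_one_mul (by lia : 2 * k ≠ 0)]
          have : τ₁ x ≠ 0 := by linarith
          field_simp
        rw [q1, q2]
        have : τ₂ x ^ (2 * k - 1) ≤ τ₁ x ^ (2 * k - 1) := by gcongr
        have e7 : (0 : ℝ) ≤ τ₁ x ^ (2 * k - 1) := by
          have : 0 < τ₁ x := by linarith
          positivity
        apply div_le_div₀ e7 this e1 (by linarith)
      have e8 : 4 * (k : ℝ) * F x ≤ 0 := by
        have : (0 : ℝ) ≤ k := by positivity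
        nlinarith
      have := mul_le_mul_of_nonpos_left e6 e8
      linarith)
  simp only [h₁.τ0, h₂.τ0, N.F0] at this
  have e1 : 0 < V₁ 0 := h₁.Vpos 0 ⟨le_refl _, lt_of_lt_of_le hc0 hc1⟩
  have e2 : V₁ 0 ^ 2 < V₂ 0 ^ 2 := by gcongr
  have e3 : 0 < a ^ (2 * k) := by have := h₁.ha; positivity
  nlinarith

/-- comparison of the Y functional, above `β` -/
lemma up_Y (N : Nl k f F m' β) (h₁ : UpBr k f F a M₁ T₁ τ₁ V₁) (h₂ : UpBr k f F a M₂ T₂ τ₂ V₂)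
    (h0 : V₁ 0 < V₂ 0) {c : ℝ} (hc1 : c ≤ M₁) (hc2 : c ≤ M₂) (hcβ : β ≤ c)
    (hV : ∀ x ∈ Ico 0 c, 0 < V₂ x - V₁ x) :
    τ₁ c ^ (2 * k) * (V₁ c ^ 2) < τ₂ c ^ (2 * k) * (V₂ c ^ 2) := by
  have hβ := N.hβ
  have hcont : ∀ {M T τ V}, UpBr k f F a M T τ V → c ≤ M →
      ContinuousOn (fun t => τ t ^ (2 * k) * (V t ^ 2)) (Icc β c) := by
    intro M T τ V h hc
    have hsub : Icc β c ⊆ Icc 0 M := Icc_subset_Icc (by linarith) hc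
    have c1 := h.cτ.mono hsub
    have c2 := h.cV.mono hsub
    fun_prop
  have key := up_Z N h₁ h₂ h0 (by linarith : 0 < β) (hcβ.trans hc1) (hcβ.trans hc2) le_rfl
    (fun x hx => hV x ⟨hx.1, hx.2.trans_le hcβ⟩)
  rw [N.Fβ] at key
  have := ax_mono (g := fun s => τ₂ s ^ (2 * k) * (V₂ s ^ 2) - τ₁ s ^ (2 * k) * (V₁ s ^ 2))
    (g' := fun s => (-(2 * f s * τ₂ s ^ (2 * k))) - (-(2 * f s * τ₁ s ^ (2 * k)))) hcβ
    ((hcont h₂ hc2).sub (hcont h₁ hc1))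
    (fun x hx => (h₂.dY ⟨by linarith [hx.1], hx.2.trans_le hc2⟩).sub
      (h₁.dY ⟨by linarith [hx.1], hx.2.trans_le hc1⟩))
    (fun x hx => by
      have e0 : 0 < x := by linarith [hx.1]
      have e3 : 0 < τ₂ x := h₂.τpos ⟨e0.le, (hx.2.trans_le hc2).le⟩
      have e4 : τ₂ x < τ₁ x := up_tau h₁ h₂ e0 (hx.2.trans_le hc1).le (hx.2.trans_le hc2).le
        (fun y hy => hV y ⟨hy.1, hy.2.trans hx.2⟩)
      have e5 := N.fpos x hx.1.le
      have : τ₂ x ^ (2 * k) ≤ τ₁ x ^ (2 * k) := by gcongr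
      nlinarith)
  nlinarith

lemma up_V (N : Nl k f F m' β) (h₁ : UpBr k f F a M₁ T₁ τ₁ V₁) (h₂ : UpBr k f F a M₂ T₂ τ₂ V₂)
    (h0 : V₁ 0 < V₂ 0) {b : ℝ} (hb1 : b ≤ M₁) (hb2 : b ≤ M₂) :
    ∀ s ∈ Icc 0 b, 0 < V₂ s - V₁ s := by
  apply ff_up
  · exact (h₂.cV.mono (Icc_subset_Icc_right hb2)).sub (h₁.cV.mono (Icc_subset_Icc_right hb1))
  · linarith
  · intro c hc hV
    have hc1 := hc.2.trans hb1
    have hc2 := hc.2.trans hb2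
    have e1 := up_tau h₁ h₂ hc.1 hc1 hc2 hV
    have e2 : 0 < τ₂ c := h₂.τpos ⟨hc.1.le, hc2⟩
    have e5 : τ₂ c ^ (2 * k) ≤ τ₁ c ^ (2 * k) := by gcongr
    have e6 : 0 < τ₂ c ^ (2 * k) := by positivity
    have e3 : 0 ≤ V₂ c := by
      rcases eq_or_lt_of_le hc2 with h | h
      · rw [h, h₂.VM]
      · exact (h₂.Vpos c ⟨hc.1.le, h⟩).le
    have key : V₁ c ^ 2 < V₂ c ^ 2 := by
      rcases le_total c β with h | h
      · have := up_Z N h₁ h₂ h0 hc.1 hc1 hc2 h hV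
        have e7 := h₁.E c ⟨hc.1.le, hc1⟩
        have : τ₂ c ^ (2 * k) * (V₁ c ^ 2 + 2 * F c) < τ₂ c ^ (2 * k) * (V₂ c ^ 2 + 2 * F c) := by
          nlinarith
        have := lt_of_mul_lt_mul_left this e6.le
        linarith
      · have := up_Y N h₁ h₂ h0 hc1 hc2 h hV
        have : τ₂ c ^ (2 * k) * (V₁ c ^ 2) < τ₂ c ^ (2 * k) * (V₂ c ^ 2) := by
          nlinarith [sq_nonneg (V₁ c)]
        exact lt_of_mul_lt_mul_left this e6.le
    have := lt_of_pow_lt_pow_left₀ 2 e3 key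
    linarith

lemma up_M (N : Nl k f F m' β) (h₁ : UpBr k f F a M₁ T₁ τ₁ V₁) (h₂ : UpBr k f F a M₂ T₂ τ₂ V₂)
    (hM₁ : β < M₁) (hM₂ : β < M₂) (h0 : V₁ 0 < V₂ 0) : M₁ < M₂ := by
  by_contra hcon
  push Not at hcon
  have hβ := N.hβ
  have := up_V N h₁ h₂ h0 hcon le_rfl M₂ ⟨by linarith, le_rfl⟩
  rw [h₂.VM] at this
  rcases eq_or_lt_of_le hcon with h | h
  · rw [h, h₁.VM] at this; linarith
  · have := h₁.Vpos M₂ ⟨by linarith, h⟩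
    linarith

/-- Erbe–Tang functional at the top on the increasing branch -/
lemma up_P (N : Nl k f F m' β) (h₁ : UpBr k f F a M₁ T₁ τ₁ V₁) (h₂ : UpBr k f F a M₂ T₂ τ₂ V₂)
    (hM₁ : β < M₁) (hM₂ : β < M₂) (h0 : V₁ 0 < V₂ 0) :
    -2 * ((k : ℝ) + 1) * (F M₁ / f M₁) * (τ₂ M₁ ^ k * V₂ M₁)
        - τ₂ M₁ ^ (k + 1) * (V₂ M₁ ^ 2 + 2 * F M₁) < - T₁ ^ (k + 1) * (2 * F M₁) := by
  have hβ := N.hβ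
  have hM := up_M N h₁ h₂ hM₁ hM₂ h0
  have hVV := up_V N h₁ h₂ h0 le_rfl hM.le
  have hsub : Icc β M₁ ⊆ Icc β M₂ := Icc_subset_Icc_right hM.le
  have := ax_mono (g := fun t => (-2 * ((k : ℝ) + 1) * (F t / f t) * (τ₁ t ^ k * V₁ t)
        - τ₁ t ^ (k + 1) * (V₁ t ^ 2 + 2 * F t)) - (-2 * ((k : ℝ) + 1) * (F t / f t) *
        (τ₂ t ^ k * V₂ t) - τ₂ t ^ (k + 1) * (V₂ t ^ 2 + 2 * F t)))
    (g' := fun s => (-((2 * ((k : ℝ) + 1) * m' s - (k - 1)) * (τ₁ s ^ k * V₁ s))) -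
      (-((2 * ((k : ℝ) + 1) * m' s - (k - 1)) * (τ₂ s ^ k * V₂ s)))) hM₁.le
    ((h₁.cP N).sub ((h₂.cP N).mono hsub))
    (fun x hx => (h₁.dP N hx).sub (h₂.dP N ⟨hx.1, hx.2.trans hM⟩))
    (fun x hx => by
      have e1 := N.hG x hx.1
      have e2 := up_Y N h₁ h₂ h0 (hx.2.le) (hx.2.le.trans hM.le) hx.1.le
        (fun y hy => hVV y ⟨hy.1, by linarith [hy.2, hx.2]⟩)
      have e3 : 0 < τ₂ x := h₂.τpos ⟨by linarith [hx.1], (hx.2.trans hM).le⟩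
      have e4 := h₂.Vpos x ⟨by linarith [hx.1], (hx.2.trans hM)⟩
      have e5 : τ₁ x ^ k * V₁ x < τ₂ x ^ k * V₂ x := by
        apply lt_of_pow_lt_pow_left₀ 2 (by positivity)
        calc _ = τ₁ x ^ (2 * k) * V₁ x ^ 2 := by ring
          _ < _ := e2
          _ = _ := by ring
      nlinarith)
  simp only [h₁.VM, h₁.τM, N.Fβ] at this
  have e2 := up_Y N h₁ h₂ h0 hM₁.le hM₂.le le_rfl
        (fun y hy => hVV y ⟨hy.1, by linarith [hy.2]⟩)
  have e3 : 0 < τ₂ β := h₂.τpos ⟨by linarith, hM₂.le⟩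
  have e4 : τ₂ β < τ₁ β := up_tau h₁ h₂ (by linarith) hM₁.le hM₂.le
        (fun y hy => hVV y ⟨hy.1, by linarith [hy.2]⟩)
  have e6 : τ₁ β ^ (k + 1) * V₁ β ^ 2 < τ₂ β ^ (k + 1) * V₂ β ^ 2 := by
    obtain ⟨j, rfl⟩ : ∃ j, k = j + 1 := ⟨k - 1, by have := N.hk; lia⟩
    have q1 : 0 < τ₁ β ^ j := by have : 0 < τ₁ β := by linarith
                                 positivity
    have q3 : 0 < τ₂ β ^ j := by positivity
    have q2 : τ₂ β ^ j ≤ τ₁ β ^ j := by gcongr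
    have q4 : τ₁ β ^ (2 * (j + 1)) * V₁ β ^ 2 = τ₁ β ^ j * (τ₁ β ^ (j + 1 + 1) * V₁ β ^ 2) := by ring
    have q5 : τ₂ β ^ (2 * (j + 1)) * V₂ β ^ 2 = τ₂ β ^ j * (τ₂ β ^ (j + 1 + 1) * V₂ β ^ 2) := by ring
    rw [q4, q5] at e2
    have q6 : 0 ≤ τ₂ β ^ (j + 1 + 1) * V₂ β ^ 2 := by positivity
    have : τ₁ β ^ j * (τ₁ β ^ (j + 1 + 1) * V₁ β ^ 2) < τ₁ β ^ j * (τ₂ β ^ (j + 1 + 1) * V₂ β ^ 2) := by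
      nlinarith
    exact lt_of_mul_lt_mul_left this q1.le
  simp at this
  nlinarith

/-- The functional decreases along the increasing branch. -/
lemma UpBr.Panti {M T : ℝ} {τ V : ℝ → ℝ} (h : UpBr k f F a M T τ V) (N : Nl k f F m' β)
    {s : ℝ} (hs : β ≤ s) (hsM : s ≤ M) :
    - T ^ (k + 1) * (2 * F M) ≤ -2 * ((k : ℝ) + 1) * (F s / f s) * (τ s ^ k * V s)
        - τ s ^ (k + 1) * (V s ^ 2 + 2 * F s) := by
  have hβ := N.hβ
  have := ax_anti (g := fun t => -2 * ((k : ℝ) + 1) * (F t / f t) * (τ t ^ k * V t)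
        - τ t ^ (k + 1) * (V t ^ 2 + 2 * F t)) hsM
    ((h.cP N).mono (Icc_subset_Icc_left hs))
    (fun x hx => h.dP N ⟨hs.trans_lt hx.1, hx.2⟩)
    (fun x hx => by
      have e1 := N.hG x (hs.trans_lt hx.1)
      have e3 : 0 < τ x := h.τpos ⟨by linarith [hx.1], hx.2.le⟩
      have e4 := h.Vpos x ⟨by linarith [hx.1], hx.2⟩
      have : 0 < τ x ^ k * V x := by positivity
      nlinarith)
  simp only [h.VM, h.τM] at this
  simp at this
  simpa using this

end up2

end partB

section partC
section dn
variable {k : ℕ} {f F m' : ℝ → ℝ} {β M T : ℝ} {ρ v : ℝ → ℝ}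

lemma DnBr.ρpos (h : DnBr k f F M T ρ v) {s : ℝ} (hs : s ∈ Ioc 0 M) : 0 < ρ s :=
  lt_of_lt_of_le h.hT (h.ρge s hs)

lemma DnBr.dy (h : DnBr k f F M T ρ v) {s : ℝ} (hs : s ∈ Ioo 0 M) :
    HasDerivAt (fun t => ρ t ^ k * v t) (-(f s * (ρ s ^ k / v s))) s := by
  have h1 := h.ρpos ⟨hs.1, hs.2.le⟩
  have h2 := h.vpos s hs
  have := (pow_der k (h.dρ s hs) h1.ne').mul (h.dv s hs)
  refine this.congr_deriv ?_
  field_simp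
  ring

lemma DnBr.dE (h : DnBr k f F M T ρ v) (N : Nl k f F m' β) {s : ℝ} (hs : s ∈ Ioo 0 M) :
    HasDerivAt (fun t => v t ^ 2 + 2 * F t) (2 * k * (v s / ρ s)) s := by
  have h1 := h.ρpos ⟨hs.1, hs.2.le⟩
  have h2 := h.vpos s hs
  have := ((h.dv s hs).pow 2).add ((N.dF s hs.1).const_mul 2)
  refine this.congr_deriv ?_
  simp
  field_simp
  ring

lemma DnBr.dP (h : DnBr k f F M T ρ v) (N : Nl k f F m' β) {s : ℝ} (hs : s ∈ Ioo β M) :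
    HasDerivAt (fun t => 2 * ((k : ℝ) + 1) * (F t / f t) * (ρ t ^ k * v t)
        - ρ t ^ (k + 1) * (v t ^ 2 + 2 * F t))
      ((2 * ((k : ℝ) + 1) * m' s - (k - 1)) * (ρ s ^ k * v s)) s := by
  have h0 : 0 < s := by linarith [N.hβ, hs.1]
  have hs' : s ∈ Ioo 0 M := ⟨h0, hs.2⟩
  have h1 := h.ρpos ⟨h0, hs.2.le⟩
  have h2 := h.vpos s hs'
  have h3 := N.fpos s hs.1.le
  have := (((N.dm s hs.1).const_mul (2 * ((k : ℝ) + 1))).mul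
      ((pow_der k (h.dρ s hs') h1.ne').mul (h.dv s hs'))).sub
    ((pow_der (k + 1) (h.dρ s hs') h1.ne').mul
    (((h.dv s hs').pow 2).add ((N.dF s hs'.1).const_mul 2)))
  refine this.congr_deriv ?_
  simp
  field_simp
  ring

lemma DnBr.cP (h : DnBr k f F M T ρ v) (N : Nl k f F m' β) :
    ContinuousOn (fun t => 2 * ((k : ℝ) + 1) * (F t / f t) * (ρ t ^ k * v t)
        - ρ t ^ (k + 1) * (v t ^ 2 + 2 * F t)) (Icc β M) := by
  have hsub : Icc β M ⊆ Ioc 0 M := fun x hx => ⟨by linarith [N.hβ, hx.1], hx.2⟩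
  have hsub2 : Icc β M ⊆ Ici 0 := fun x hx => le_trans (by linarith [N.hβ]) hx.1
  have c1 := h.cρ.mono hsub
  have c2 := h.cv.mono hsub
  have c3 := N.contF.mono hsub2
  have c4 := N.contf.mono hsub2
  have c5 : ContinuousOn (fun t => F t / f t) (Icc β M) :=
    c3.div c4 (fun x hx => (N.fpos x hx.1).ne')
  fun_prop

/-- The functional decreases along the decreasing branch. -/
lemma DnBr.Pmono (h : DnBr k f F M T ρ v) (N : Nl k f F m' β)
    {s : ℝ} (hs : β ≤ s) (hsM : s ≤ M) :
    2 * ((k : ℝ) + 1) * (F s / f s) * (ρ s ^ k * v s)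
        - ρ s ^ (k + 1) * (v s ^ 2 + 2 * F s) ≤ - T ^ (k + 1) * (2 * F M) := by
  have hβ := N.hβ
  have := ax_mono (g := fun t => 2 * ((k : ℝ) + 1) * (F t / f t) * (ρ t ^ k * v t)
        - ρ t ^ (k + 1) * (v t ^ 2 + 2 * F t)) hsM
    ((h.cP N).mono (Icc_subset_Icc_left hs))
    (fun x hx => h.dP N ⟨hs.trans_lt hx.1, hx.2⟩)
    (fun x hx => by
      have e1 := N.hG x (hs.trans_lt hx.1)
      have e0 : 0 < x := by linarith [hx.1]
      have e3 : 0 < ρ x := h.ρpos ⟨e0, hx.2.le⟩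
      have e4 := h.vpos x ⟨e0, hx.2⟩
      have : 0 < ρ x ^ k * v x := by positivity
      exact mul_nonneg (by linarith) this.le)
  simp only [h.vM, h.ρM] at this
  simp at this
  simpa using this

end dn

section dn2
variable {k : ℕ} {f F m' : ℝ → ℝ} {β M₁ T₁ M₂ T₂ : ℝ} {ρ₁ v₁ ρ₂ v₂ : ℝ → ℝ}

/-- energy crossing argument -/
lemma dn_cross (N : Nl k f F m' β) (h₁ : DnBr k f F M₁ T₁ ρ₁ v₁) (h₂ : DnBr k f F M₂ T₂ ρ₂ v₂)
    (hM : M₁ < M₂) {c d : ℝ} (hc0 : 0 < c) (hcd : c < d) (hd : d ≤ M₁)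
    (hv : ∀ x ∈ Ioc c d, 0 < v₂ x - v₁ x) (heq : v₁ c = v₂ c) (hρ : ρ₁ c < ρ₂ c) : False := by
  have hc1 : c ∈ Ioo 0 M₁ := ⟨hc0, hcd.trans_le hd⟩
  have hc2 : c ∈ Ioo 0 M₂ := ⟨hc0, hc1.2.trans hM⟩
  have hD := (h₁.dE N hc1).sub (h₂.dE N hc2)
  have hp : 0 < ρ₁ c := h₁.ρpos ⟨hc1.1, hc1.2.le⟩
  have hvp : 0 < v₁ c := h₁.vpos c hc1
  have hpos : 0 < 2 * (k : ℝ) * (v₁ c / ρ₁ c) - 2 * k * (v₂ c / ρ₂ c) := by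
    rw [← heq]
    have hk : (0 : ℝ) < k := by have := N.hk; exact_mod_cast this
    have : v₁ c / ρ₂ c < v₁ c / ρ₁ c := by gcongr
    nlinarith
  have := hD.hasDerivWithinAt (s := Ioi c)
  rw [hasDerivWithinAt_iff_tendsto_slope' (by simp)] at this
  have h3 := this.eventually (lt_mem_nhds hpos)
  have h4 : ∀ᶠ x in nhdsWithin c (Ioi c), x ∈ Ioo c d := Ioo_mem_nhdsGT hcd
  obtain ⟨x, hx1, hx2⟩ := (h3.and h4).exists
  rw [slope_def_field] at hx1
  have hx3 := (div_pos_iff_of_pos_right (by linarith [hx2.1] : 0 < x - c)).1 hx1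
  have hx4 := hv x ⟨hx2.1, hx2.2.le⟩
  have hx5 := h₁.vpos x ⟨hc0.trans hx2.1, hx2.2.trans_le hd⟩
  simp [heq] at hx3
  nlinarith

/-- difference of radii increases while `v₁ < v₂` when going down -/
lemma dn_delta (h₁ : DnBr k f F M₁ T₁ ρ₁ v₁) (h₂ : DnBr k f F M₂ T₂ ρ₂ v₂)
    (hM : M₁ < M₂) {c d : ℝ} (hc0 : 0 < c) (hcd : c ≤ d) (hd : d ≤ M₁)
    (hv : ∀ x ∈ Ioo c d, 0 < v₂ x - v₁ x) : ρ₁ d - ρ₂ d ≤ ρ₁ c - ρ₂ c := by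
  have := ax_anti (g := fun s => ρ₁ s - ρ₂ s) (g' := fun s => -(1 / v₁ s) - -(1 / v₂ s)) hcd
    ((h₁.cρ.mono (fun x hx => ⟨hc0.trans_le hx.1, hx.2.trans hd⟩)).sub
      (h₂.cρ.mono (fun x hx => ⟨hc0.trans_le hx.1, hx.2.trans (hd.trans hM.le)⟩)))
    (fun x hx => (h₁.dρ x ⟨hc0.trans hx.1, hx.2.trans_le hd⟩).sub
      (h₂.dρ x ⟨hc0.trans hx.1, (hx.2.trans_le hd).trans hM⟩))
    (fun x hx => by
      have e1 := h₁.vpos x ⟨hc0.trans hx.1, hx.2.trans_le hd⟩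
      have e2 := hv x hx
      have := one_div_lt_one_div_of_lt e1 (by linarith : v₁ x < v₂ x)
      linarith)
  exact this

/-- key Erbe–Tang comparison -/
lemma dn_D (N : Nl k f F m' β) (h₁ : DnBr k f F M₁ T₁ ρ₁ v₁) (h₂ : DnBr k f F M₂ T₂ ρ₂ v₂)
    (hM₁ : β < M₁) (hM : M₁ < M₂)
    (hP2 : - T₂ ^ (k + 1) * (2 * F M₂) < - T₁ ^ (k + 1) * (2 * F M₁))
    {c : ℝ} (hcβ : β ≤ c) (hc1 : c < M₁)
    (hv : ∀ x ∈ Ioc c M₁, 0 < v₂ x - v₁ x) :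
    (ρ₁ c ^ k * v₁ c ≤ ρ₂ c ^ k * v₂ c →
      2 * ((k : ℝ) + 1) * (F c / f c) * (ρ₂ c ^ k * v₂ c) - ρ₂ c ^ (k + 1) * (v₂ c ^ 2 + 2 * F c) <
      2 * ((k : ℝ) + 1) * (F c / f c) * (ρ₁ c ^ k * v₁ c) - ρ₁ c ^ (k + 1) * (v₁ c ^ 2 + 2 * F c)) ∧
    (ρ₂ c ^ k * v₂ c < ρ₁ c ^ k * v₁ c →
      0 < (ρ₁ c ^ k * v₁ c) / (ρ₂ c ^ k * v₂ c) * (ρ₂ c ^ (k + 1) * (v₂ c ^ 2 + 2 * F c)) -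
        ρ₁ c ^ (k + 1) * (v₁ c ^ 2 + 2 * F c)) := by
  have hβ := N.hβ
  set P₁ : ℝ → ℝ := fun t => 2 * ((k : ℝ) + 1) * (F t / f t) * (ρ₁ t ^ k * v₁ t)
        - ρ₁ t ^ (k + 1) * (v₁ t ^ 2 + 2 * F t) with hP₁
  set P₂ : ℝ → ℝ := fun t => 2 * ((k : ℝ) + 1) * (F t / f t) * (ρ₂ t ^ k * v₂ t)
        - ρ₂ t ^ (k + 1) * (v₂ t ^ 2 + 2 * F t) with hP₂
  set S : ℝ → ℝ := fun t => (ρ₁ t ^ k * v₁ t) / (ρ₂ t ^ k * v₂ t) with hS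
  set S' : ℝ → ℝ := fun t => ((-(f t * (ρ₁ t ^ k / v₁ t))) * (ρ₂ t ^ k * v₂ t) -
    (ρ₁ t ^ k * v₁ t) * (-(f t * (ρ₂ t ^ k / v₂ t)))) / (ρ₂ t ^ k * v₂ t) ^ 2 with hS'
  have hc0 : 0 < c := by linarith
  have m1 : ∀ x, c ≤ x → x ≤ M₁ → x ∈ Ioc 0 M₁ := fun x h1 h2 => ⟨hc0.trans_le h1, h2⟩
  have m2 : ∀ x, c ≤ x → x ≤ M₁ → x ∈ Ioo 0 M₂ :=
    fun x h1 h2 => ⟨hc0.trans_le h1, h2.trans_lt hM⟩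
  have y2pos : ∀ x, c ≤ x → x ≤ M₁ → 0 < ρ₂ x ^ k * v₂ x := fun x h1 h2 => by
    have := h₂.ρpos (Ioo_subset_Ioc_self (m2 x h1 h2))
    have := h₂.vpos x (m2 x h1 h2)
    positivity
  have cy1 : ContinuousOn (fun t => ρ₁ t ^ k * v₁ t) (Icc c M₁) := by
    have c1 := h₁.cρ.mono (fun x (hx : x ∈ Icc c M₁) => m1 x hx.1 hx.2)
    have c2 := h₁.cv.mono (fun x (hx : x ∈ Icc c M₁) => m1 x hx.1 hx.2)
    fun_prop
  have cy2 : ContinuousOn (fun t => ρ₂ t ^ k * v₂ t) (Icc c M₁) := by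
    have c1 := h₂.cρ.mono (fun x (hx : x ∈ Icc c M₁) => Ioo_subset_Ioc_self (m2 x hx.1 hx.2))
    have c2 := h₂.cv.mono (fun x (hx : x ∈ Icc c M₁) => Ioo_subset_Ioc_self (m2 x hx.1 hx.2))
    fun_prop
  have cS : ContinuousOn S (Icc c M₁) := cy1.div cy2 (fun x hx => (y2pos x hx.1 hx.2).ne')
  have cP1 : ContinuousOn P₁ (Icc c M₁) := (h₁.cP N).mono (Icc_subset_Icc_left hcβ)
  have cP2 : ContinuousOn P₂ (Icc c M₁) := (h₂.cP N).mono (Icc_subset_Icc hcβ hM.le)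
  have dS : ∀ x ∈ Ioo c M₁, HasDerivAt S (S' x) x := fun x hx =>
    (h₁.dy ⟨hc0.trans hx.1, hx.2⟩).div (h₂.dy (m2 x hx.1.le hx.2.le)) (y2pos x hx.1.le hx.2.le).ne'
  have dP1 : ∀ x ∈ Ioo c M₁, HasDerivAt P₁ _ x := fun x hx => h₁.dP N ⟨hcβ.trans_lt hx.1, hx.2⟩
  have dP2 : ∀ x ∈ Ioo c M₁, HasDerivAt P₂ _ x :=
    fun x hx => h₂.dP N ⟨hcβ.trans_lt hx.1, hx.2.trans hM⟩
  have S'neg : ∀ x ∈ Ioo c M₁, S' x ≤ 0 := fun x hx => by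
    have e1 := h₁.vpos x ⟨hc0.trans hx.1, hx.2⟩
    have e2 := hv x ⟨hx.1, hx.2.le⟩
    have e3 := N.fpos x (hcβ.trans hx.1.le)
    have e4 : 0 < ρ₁ x ^ k := by
      have := h₁.ρpos (m1 x hx.1.le hx.2.le); positivity
    have e5 : 0 < ρ₂ x ^ k := by
      have := h₂.ρpos (Ioo_subset_Ioc_self (m2 x hx.1.le hx.2.le)); positivity
    have e6 : 0 < v₂ x := by linarith
    apply div_nonpos_of_nonpos_of_nonneg _ (sq_nonneg _)
    have : (-(f x * (ρ₁ x ^ k / v₁ x))) * (ρ₂ x ^ k * v₂ x) -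
      (ρ₁ x ^ k * v₁ x) * (-(f x * (ρ₂ x ^ k / v₂ x))) =
      - (f x * ρ₁ x ^ k * ρ₂ x ^ k / (v₁ x * v₂ x) * ((v₂ x - v₁ x) * (v₂ x + v₁ x))) := by
      field_simp; ring
    rw [this]
    have : 0 < f x * ρ₁ x ^ k * ρ₂ x ^ k / (v₁ x * v₂ x) * ((v₂ x - v₁ x) * (v₂ x + v₁ x)) := by
      have : 0 < v₂ x + v₁ x := by linarith
      positivity
    linarith
  have Santi : ∀ x y, c ≤ x → x ≤ y → y ≤ M₁ → S y ≤ S x := fun x y h1 h2 h3 =>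
    ax_anti h2 (cS.mono (Icc_subset_Icc h1 h3))
      (fun z hz => dS z ⟨h1.trans_lt hz.1, hz.2.trans_le h3⟩)
      (fun z hz => S'neg z ⟨h1.trans_lt hz.1, hz.2.trans_le h3⟩)
  have topP : P₂ M₁ < P₁ M₁ := by
    have e1 := h₂.Pmono N hM₁.le hM.le
    have e2 : P₁ M₁ = - T₁ ^ (k + 1) * (2 * F M₁) := by
      simp [hP₁, h₁.vM, h₁.ρM]
    rw [e2]
    exact lt_of_le_of_lt e1 hP2
  have hPP : ∀ x, c ≤ x → x ≤ M₁ → S x ≤ 1 → P₂ x < P₁ x := fun x h1 h2 h3 => by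
    have := ax_anti (g := fun t => P₁ t - P₂ t) h2
      ((cP1.sub cP2).mono (Icc_subset_Icc_left h1))
      (fun z hz => (dP1 z ⟨h1.trans_lt hz.1, hz.2⟩).sub (dP2 z ⟨h1.trans_lt hz.1, hz.2⟩))
      (fun z hz => by
        have e1 := N.hG z (hcβ.trans_lt (h1.trans_lt hz.1))
        have e2 : S z ≤ 1 := (Santi x z h1 hz.1.le hz.2.le).trans h3
        have e3 : ρ₁ z ^ k * v₁ z ≤ ρ₂ z ^ k * v₂ z := by
          rwa [hS, div_le_one (y2pos z (h1.trans hz.1.le) hz.2.le)] at e2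
        nlinarith)
    linarith
  constructor
  · intro h
    exact hPP c le_rfl hc1.le (by rw [hS]; exact (div_le_one (y2pos c le_rfl hc1.le)).2 h)
  · intro h
    have hS1 : 1 < S c := by rw [hS]; exact (one_lt_div (y2pos c le_rfl hc1.le)).2 h
    have hS0 : S M₁ = 0 := by simp [hS, h₁.vM]
    obtain ⟨s0, hs0, hs1⟩ := intermediate_value_Icc' hc1.le cS (show (1 : ℝ) ∈ Icc (S M₁) (S c) by
      rw [hS0]; exact ⟨zero_le_one, hS1.le⟩)
    have hpp := hPP s0 hs0.1 hs0.2 hs1.le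
    have := ax_anti (g := fun t => P₁ t - S t * P₂ t)
      (g' := fun x => (2 * ((k : ℝ) + 1) * m' x - (k - 1)) * (ρ₁ x ^ k * v₁ x) -
        (S' x * P₂ x + S x * ((2 * ((k : ℝ) + 1) * m' x - (k - 1)) * (ρ₂ x ^ k * v₂ x)))) hs0.1
      ((cP1.sub (cS.mul cP2)).mono (Icc_subset_Icc_right hs0.2))
      (fun z hz => (dP1 z ⟨hz.1, hz.2.trans_le hs0.2⟩).sub
        ((dS z ⟨hz.1, hz.2.trans_le hs0.2⟩).mul (dP2 z ⟨hz.1, hz.2.trans_le hs0.2⟩)))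
      (fun z hz => by
        have hz2 : z < M₁ := hz.2.trans_le hs0.2
        have e1 := y2pos z hz.1.le hz2.le
        have e2 : S z * (ρ₂ z ^ k * v₂ z) = ρ₁ z ^ k * v₁ z := by
          simp only [hS]; exact div_mul_cancel₀ _ e1.ne'
        have e3 := S'neg z ⟨hz.1, hz2⟩
        have e4 : P₂ z < 0 := by
          have q1 := h₂.Pmono N (hcβ.trans hz.1.le) (hz2.trans hM).le
          have q2 : 0 < T₂ ^ (k + 1) * (2 * F M₂) := by
            have := h₂.hT
            have := N.Fpos M₂ (hM₁.trans hM)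
            positivity
          simp only [hP₂]
          linarith
        have e5 : (2 * ((k : ℝ) + 1) * m' z - (k - 1)) * (ρ₁ z ^ k * v₁ z) -
          (S' z * P₂ z + S z * ((2 * ((k : ℝ) + 1) * m' z - (k - 1)) * (ρ₂ z ^ k * v₂ z))) =
          - (S' z * P₂ z) := by
          rw [← e2]; ring
        rw [e5]
        nlinarith [mul_nonneg_of_nonpos_of_nonpos e3 e4.le])
    simp only [hs1] at this
    have hfin : P₁ c - S c * P₂ c = S c * (ρ₂ c ^ (k + 1) * (v₂ c ^ 2 + 2 * F c)) -
        ρ₁ c ^ (k + 1) * (v₁ c ^ 2 + 2 * F c) := by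
      have e1 := y2pos c le_rfl hc1.le
      have e2 : S c * (ρ₂ c ^ k * v₂ c) = ρ₁ c ^ k * v₁ c := by
        simp only [hS]; exact div_mul_cancel₀ _ e1.ne'
      simp only [hP₁, hP₂]
      rw [← e2]; ring
    have : 0 < P₁ c - S c * P₂ c := by linarith
    rw [hfin] at this
    exact this

/-- no crossing of the speeds above `β` -/
lemma dn_v (N : Nl k f F m' β) (h₁ : DnBr k f F M₁ T₁ ρ₁ v₁) (h₂ : DnBr k f F M₂ T₂ ρ₂ v₂)
    (hM₁ : β < M₁) (hM : M₁ < M₂)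
    (hP2 : - T₂ ^ (k + 1) * (2 * F M₂) < - T₁ ^ (k + 1) * (2 * F M₁))
    (huniq : ∀ s ∈ Ioo 0 M₁, ¬ (ρ₁ s = ρ₂ s ∧ v₁ s = v₂ s)) :
    ∀ s ∈ Icc β M₁, 0 < v₂ s - v₁ s := by
  have hβ := N.hβ
  have cc : ContinuousOn (fun s => v₂ s - v₁ s) (Icc β M₁) :=
    (h₂.cv.mono (fun x hx => ⟨by linarith [hx.1], hx.2.trans hM.le⟩)).sub
      (h₁.cv.mono (fun x hx => ⟨by linarith [hx.1], hx.2⟩))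
  refine ff_dn cc ?_ ?_
  · rw [h₁.vM]
    have := h₂.vpos M₁ ⟨by linarith, hM⟩
    linarith
  · intro c hc hv
    by_contra hcon
    push Not at hcon
    have hc0 : 0 < c := by linarith [hc.1]
    have hge : 0 ≤ v₂ c - v₁ c := by
      have h1 : ContinuousWithinAt (fun s => v₂ s - v₁ s) (Ioc c M₁) c :=
        (cc c ⟨hc.1, hc.2.le⟩).mono (fun x hx => ⟨hc.1.trans hx.1.le, hx.2⟩)
      have : (nhdsWithin c (Ioc c M₁)).NeBot := by
        rw [nhdsWithin_Ioc_eq_nhdsGT hc.2]; infer_instance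
      exact ge_of_tendsto h1 (eventually_nhdsWithin_of_forall fun x hx => (hv x hx).le)
    have heq : v₁ c = v₂ c := by linarith
    have hv1 := h₁.vpos c ⟨hc0, hc.2⟩
    rcases lt_trichotomy (ρ₁ c) (ρ₂ c) with h | h | h
    · exact dn_cross N h₁ h₂ hM hc0 hc.2 le_rfl hv heq h
    · exact huniq c ⟨hc0, hc.2⟩ ⟨h, heq⟩
    · have hk : k ≠ 0 := by have := N.hk; lia
      have p2 : 0 < ρ₂ c := h₂.ρpos ⟨hc0, (hc.2.trans hM).le⟩
      have p1 : 0 < ρ₁ c := h₁.ρpos ⟨hc0, hc.2.le⟩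
      have hpow : ρ₂ c ^ k < ρ₁ c ^ k := pow_lt_pow_left₀ h p2.le hk
      have := (dn_D N h₁ h₂ hM₁ hM hP2 hc.1 hc.2 hv).2 (by rw [heq]; rw [heq] at hv1; gcongr)
      rw [heq] at this
      have hE := h₂.E c ⟨hc0, (hc.2.trans hM).le⟩
      have hv2 : 0 < v₂ c := by linarith
      have e : ρ₁ c ^ k * v₂ c / (ρ₂ c ^ k * v₂ c) * (ρ₂ c ^ (k + 1) * (v₂ c ^ 2 + 2 * F c)) -
        ρ₁ c ^ (k + 1) * (v₂ c ^ 2 + 2 * F c) =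
        ρ₁ c ^ k * (v₂ c ^ 2 + 2 * F c) * (ρ₂ c - ρ₁ c) := by
        field_simp
        ring
      rw [e] at this
      have : 0 < ρ₁ c ^ k * (v₂ c ^ 2 + 2 * F c) := by positivity
      nlinarith

/-- at `β`, ordering of `ρ v` -/
lemma dn_beta (N : Nl k f F m' β) (h₁ : DnBr k f F M₁ T₁ ρ₁ v₁) (h₂ : DnBr k f F M₂ T₂ ρ₂ v₂)
    (hM₁ : β < M₁) (hM : M₁ < M₂)
    (hP2 : - T₂ ^ (k + 1) * (2 * F M₂) < - T₁ ^ (k + 1) * (2 * F M₁))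
    (hv : ∀ s ∈ Icc β M₁, 0 < v₂ s - v₁ s) (hρ : ρ₂ β ≤ ρ₁ β) : ρ₁ β * v₁ β < ρ₂ β * v₂ β := by
  have hβ := N.hβ
  have hβ0 : 0 < β := by linarith
  have p2 : 0 < ρ₂ β := h₂.ρpos ⟨hβ0, (hM₁.trans hM).le⟩
  have p1 : 0 < ρ₁ β := h₁.ρpos ⟨hβ0, hM₁.le⟩
  have w1 : 0 < v₁ β := h₁.vpos β ⟨hβ0, hM₁⟩
  have w2 : 0 < v₂ β := h₂.vpos β ⟨hβ0, hM₁.trans hM⟩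
  have key := dn_D N h₁ h₂ hM₁ hM hP2 le_rfl hM₁ (fun x hx => hv x ⟨hx.1.le, hx.2⟩)
  rw [N.Fβ] at key
  rcases le_or_gt (ρ₁ β ^ k * v₁ β) (ρ₂ β ^ k * v₂ β) with h | h
  · have := key.1 h
    simp at this
    obtain ⟨j, rfl⟩ : ∃ j, k = j + 1 := ⟨k - 1, by have := N.hk; lia⟩
    have q2 : ρ₂ β ^ j ≤ ρ₁ β ^ j := by gcongr
    have q1 : 0 < ρ₁ β ^ j := by positivity
    have q4 : ρ₁ β ^ (j + 1 + 1) * v₁ β ^ 2 = ρ₁ β ^ j * (ρ₁ β * v₁ β) ^ 2 := by ring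
    have q5 : ρ₂ β ^ (j + 1 + 1) * v₂ β ^ 2 = ρ₂ β ^ j * (ρ₂ β * v₂ β) ^ 2 := by ring
    rw [q4, q5] at this
    have q6 : ρ₁ β ^ j * (ρ₁ β * v₁ β) ^ 2 < ρ₁ β ^ j * (ρ₂ β * v₂ β) ^ 2 := by
      nlinarith [sq_nonneg (ρ₂ β * v₂ β)]
    exact lt_of_pow_lt_pow_left₀ 2 (by positivity) (lt_of_mul_lt_mul_left q6 q1.le)
  · have := key.2 h
    have e : ρ₁ β ^ k * v₁ β / (ρ₂ β ^ k * v₂ β) * (ρ₂ β ^ (k + 1) * (v₂ β ^ 2 + 2 * 0)) -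
        ρ₁ β ^ (k + 1) * (v₁ β ^ 2 + 2 * 0) =
        ρ₁ β ^ k * v₁ β * (ρ₂ β * v₂ β - ρ₁ β * v₁ β) := by
      field_simp
      ring
    rw [e] at this
    have h3 : 0 < ρ₁ β ^ k * v₁ β := by positivity
    have := (mul_pos_iff_of_pos_left h3).1 this
    linarith

end dn2

end partC

section partD
variable {k : ℕ} {f F m' : ℝ → ℝ} {β M T : ℝ} {ρ v : ℝ → ℝ}

lemma DnBr.dW (h : DnBr k f F M T ρ v) (N : Nl k f F m' β) {s : ℝ} (hs : s ∈ Ioo 0 M) :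
    HasDerivAt (fun t => ρ t * Real.sqrt (v t ^ 2 + 2 * F t))
      (k / (Real.sqrt (v s ^ 2 + 2 * F s) / v s) - Real.sqrt (v s ^ 2 + 2 * F s) / v s) s := by
  have he := h.E s ⟨hs.1, hs.2.le⟩
  have hv := h.vpos s hs
  have hr := h.ρpos ⟨hs.1, hs.2.le⟩
  have := (h.dρ s hs).mul ((h.dE N hs).sqrt he.ne')
  refine this.congr_deriv ?_
  have hsq : 0 < Real.sqrt (v s ^ 2 + 2 * F s) := Real.sqrt_pos.2 he
  field_simp
  ring

lemma DnBr.cW (h : DnBr k f F M T ρ v) (N : Nl k f F m' β) :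
    ContinuousOn (fun t => ρ t * Real.sqrt (v t ^ 2 + 2 * F t)) (Ioc 0 M) :=
  h.cρ.mul (((h.cv.pow 2).add (continuousOn_const.mul
    (N.contF.mono (fun _ hx => hx.1.le)))).sqrt)

lemma y_mono {v₁ v₂ G : ℝ} (h1 : 0 < v₁) (h12 : v₁ < v₂) (hG : G ≤ 0) (e1 : 0 < v₁ ^ 2 + G) :
    Real.sqrt (v₁ ^ 2 + G) / v₁ ≤ Real.sqrt (v₂ ^ 2 + G) / v₂ := by
  have h2 : 0 < v₂ := h1.trans h12
  rw [div_le_div_iff₀ h1 h2]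
  have e2 : 0 < v₂ ^ 2 + G := by nlinarith
  refine (abs_le_of_sq_le_sq' ?_ ?_).2
  · rw [mul_pow, mul_pow, Real.sq_sqrt e1.le, Real.sq_sqrt e2.le]
    nlinarith [mul_pos (sub_pos.2 h12) (add_pos h1 h2)]
  · positivity
variable {M₁ M₂ T₁ T₂ : ℝ} {ρ₁ ρ₂ v₁ v₂ : ℝ → ℝ}

lemma dn_W (N : Nl k f F m' β) (h₁ : DnBr k f F M₁ T₁ ρ₁ v₁) (h₂ : DnBr k f F M₂ T₂ ρ₂ v₂)
    (hM₁ : β < M₁) (hM : M₁ < M₂) {s0 : ℝ} (hs0 : 0 < s0) (hsβ : s0 ≤ β)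
    (hρ : ρ₂ s0 ≤ ρ₁ s0)
    (hW : ρ₁ s0 * Real.sqrt (v₁ s0 ^ 2 + 2 * F s0) < ρ₂ s0 * Real.sqrt (v₂ s0 ^ 2 + 2 * F s0)) :
    False := by
  set W₁ := fun t => ρ₁ t * Real.sqrt (v₁ t ^ 2 + 2 * F t) with hW₁
  set W₂ := fun t => ρ₂ t * Real.sqrt (v₂ t ^ 2 + 2 * F t) with hW₂
  -- pointwise comparison
  have pw : ∀ c, 0 < c → c ≤ s0 → ρ₂ c ≤ ρ₁ c → W₁ c < W₂ c → 0 < v₂ c - v₁ c := by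
    intro c hc hc0 hr hw
    have p2 := h₂.ρpos (s := c) ⟨hc, by linarith⟩
    have e1 := h₁.E c ⟨hc, by linarith⟩
    have e2 := h₂.E c ⟨hc, by linarith⟩
    have v1 := h₁.vpos c ⟨hc, by linarith⟩
    have v2 := h₂.vpos c ⟨hc, by linarith⟩
    simp only [hW₁, hW₂] at hw
    by_contra hcon
    push Not at hcon
    have : Real.sqrt (v₂ c ^ 2 + 2 * F c) ≤ Real.sqrt (v₁ c ^ 2 + 2 * F c) := by
      apply Real.sqrt_le_sqrt
      nlinarith
    have := mul_le_mul hr this (Real.sqrt_nonneg _) (p2.le.trans hr)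
    linarith
  have Wd : ∀ c, 0 < c → c ≤ s0 → (∀ x ∈ Ioc c s0, 0 < v₂ x - v₁ x) →
      W₂ s0 - W₁ s0 ≤ W₂ c - W₁ c := by
    intro c hc hc0 hv
    refine ax_anti (g := fun t => W₂ t - W₁ t) hc0
      (((h₂.cW N).mono (fun x hx => ⟨hc.trans_le hx.1, by linarith [hx.2]⟩)).sub
        ((h₁.cW N).mono (fun x hx => ⟨hc.trans_le hx.1, by linarith [hx.2]⟩)))
      (fun x hx => (h₂.dW N ⟨hc.trans hx.1, by linarith [hx.2]⟩).sub
        (h₁.dW N ⟨hc.trans hx.1, by linarith [hx.2]⟩)) ?_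
    intro x hx
    have hx0 : 0 < x := hc.trans hx.1
    have v1 := h₁.vpos x ⟨hx0, by linarith [hx.2]⟩
    have e1 := h₁.E x ⟨hx0, by linarith [hx.2]⟩
    have hG : 2 * F x ≤ 0 := by
      have := N.Fneg x ⟨hx0.le, by linarith [hx.2]⟩
      linarith
    have hvx := hv x ⟨hx.1, hx.2.le⟩
    have hy := y_mono v1 (by linarith : v₁ x < v₂ x) hG e1
    have hy0 : 0 < Real.sqrt (v₁ x ^ 2 + 2 * F x) / v₁ x := div_pos (Real.sqrt_pos.2 e1) v1
    have hk : (k : ℝ) / (Real.sqrt (v₂ x ^ 2 + 2 * F x) / v₂ x) ≤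
        k / (Real.sqrt (v₁ x ^ 2 + 2 * F x) / v₁ x) := by gcongr
    linarith
  have hall : ∀ c, 0 < c → c ≤ s0 → 0 < v₂ c - v₁ c := by
    intro c hc hc0
    refine ff_dn (g := fun t => v₂ t - v₁ t) (a := c) (b := s0) ?_ ?_ ?_ c ⟨le_rfl, hc0⟩
    · exact (h₂.cv.mono (fun x hx => ⟨hc.trans_le hx.1, by linarith [hx.2]⟩)).sub
        (h₁.cv.mono (fun x hx => ⟨hc.trans_le hx.1, by linarith [hx.2]⟩))
    · exact pw s0 hs0 le_rfl hρ hW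
    · intro x hx hv
      have hx0 : 0 < x := hc.trans_le hx.1
      have d1 := dn_delta h₁ h₂ hM hx0 hx.2.le (by linarith) (fun z hz => hv z ⟨hz.1, hz.2.le⟩)
      have d2 := Wd x hx0 hx.2.le hv
      have d3 : W₁ s0 < W₂ s0 := hW
      exact pw x hx0 hx.2.le (by linarith) (by linarith)
  set d := W₂ s0 - W₁ s0 with hd
  have hdpos : 0 < d := by have : W₁ s0 < W₂ s0 := hW; linarith
  have hlow : ∀ c, 0 < c → c ≤ s0 → d ≤ ρ₂ c * v₂ c := by
    intro c hc hc0
    have d2 := Wd c hc hc0 (fun x hx => hall x (hc.trans hx.1) hx.2)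
    have p1 := h₁.ρpos (s := c) ⟨hc, by linarith⟩
    have p2 := h₂.ρpos (s := c) ⟨hc, by linarith⟩
    have w1 : 0 ≤ W₁ c := by simp only [hW₁]; positivity
    have v2 := h₂.vpos c ⟨hc, by linarith⟩
    have : Real.sqrt (v₂ c ^ 2 + 2 * F c) ≤ v₂ c := by
      rw [Real.sqrt_le_left v2.le]
      have := N.Fneg c ⟨hc.le, by linarith⟩
      linarith
    have : W₂ c ≤ ρ₂ c * v₂ c := by simp only [hW₂]; gcongr
    linarith
  have hlog : ∀ c, 0 < c → c < s0 → Real.log (ρ₂ c) ≤ Real.log (ρ₂ s0) + s0 / d := by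
    intro c hc hc0
    have := ax_mono (g := fun t => Real.log (ρ₂ t) + t / d)
      (g' := fun t => -(1 / v₂ t) / ρ₂ t + 1 / d) hc0.le
      ((ContinuousOn.log (h₂.cρ.mono (fun x hx => ⟨hc.trans_le hx.1, by linarith [hx.2]⟩))
        (fun x hx => (h₂.ρpos ⟨hc.trans_le hx.1, by linarith [hx.2]⟩).ne')).add
        (continuousOn_id.div_const d))
      (fun x hx => ((h₂.dρ x ⟨hc.trans hx.1, by linarith [hx.2]⟩).log
        (h₂.ρpos ⟨hc.trans hx.1, by linarith [hx.2]⟩).ne').add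
        ((hasDerivAt_id x).div_const d)) (by
        intro x hx
        have hx0 := hc.trans hx.1
        have v2 := h₂.vpos x ⟨hx0, by linarith [hx.2]⟩
        have p2 := h₂.ρpos (s := x) ⟨hx0, by linarith [hx.2]⟩
        have := hlow x hx0 hx.2.le
        have e : -(1 / v₂ x) / ρ₂ x = - (1 / (ρ₂ x * v₂ x)) := by field_simp
        rw [e]
        have : 1 / (ρ₂ x * v₂ x) ≤ 1 / d := one_div_le_one_div_of_le hdpos this
        linarith)
    have hcd : 0 < c / d := by positivity
    linarith
  have l1 := h₂.lim.eventually_gt_atTop (Real.exp (Real.log (ρ₂ s0) + s0 / d))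
  have l2 : ∀ᶠ c in nhdsWithin (0:ℝ) (Ioi 0), c ∈ Ioo 0 s0 := Ioo_mem_nhdsGT hs0
  obtain ⟨c, hc1, hc2⟩ := (l1.and l2).exists
  have h3 := hlog c hc2.1 hc2.2
  rw [Real.log_le_iff_le_exp (h₂.ρpos ⟨hc2.1, by linarith [hc2.2]⟩)] at h3
  linarith

/-- main conclusion on the decreasing branches: `ρ₁ < ρ₂` on `[1, M₁]` -/
lemma dn_main (N : Nl k f F m' β) (h₁ : DnBr k f F M₁ T₁ ρ₁ v₁) (h₂ : DnBr k f F M₂ T₂ ρ₂ v₂)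
    (hM₁ : β < M₁) (hM : M₁ < M₂)
    (hP2 : - T₂ ^ (k + 1) * (2 * F M₂) < - T₁ ^ (k + 1) * (2 * F M₁))
    (huniq : ∀ s ∈ Ioo 0 M₁, ¬ (ρ₁ s = ρ₂ s ∧ v₁ s = v₂ s)) :
    ∀ s ∈ Icc 1 M₁, ρ₁ s < ρ₂ s := by
  have hβ := N.hβ
  have hv := dn_v N h₁ h₂ hM₁ hM hP2 huniq
  have hδβ : ρ₁ β < ρ₂ β := by
    by_contra hcon
    push Not at hcon
    have hb := dn_beta N h₁ h₂ hM₁ hM hP2 hv hcon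
    refine dn_W N h₁ h₂ hM₁ hM (by linarith : (0:ℝ) < β) le_rfl hcon ?_
    rw [N.Fβ]
    have v1 := h₁.vpos β ⟨by linarith, hM₁⟩
    have v2 := h₂.vpos β ⟨by linarith, hM₁.trans hM⟩
    simp only [mul_zero, add_zero]
    rwa [Real.sqrt_sq v1.le, Real.sqrt_sq v2.le]
  have hup : ∀ s ∈ Icc β M₁, ρ₁ s < ρ₂ s := by
    intro s hs
    have := dn_delta h₁ h₂ hM (c := β) (d := s) (by linarith) hs.1 hs.2
      (fun x hx => hv x ⟨hx.1.le, hx.2.le.trans hs.2⟩)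
    linarith
  have cδ : ContinuousOn (fun s => ρ₂ s - ρ₁ s) (Icc 1 β) :=
    (h₂.cρ.mono (fun x hx => ⟨by linarith [hx.1], by linarith [hx.2]⟩)).sub
      (h₁.cρ.mono (fun x hx => ⟨by linarith [hx.1], by linarith [hx.2]⟩))
  have hlo : ∀ s ∈ Icc 1 β, 0 < ρ₂ s - ρ₁ s := by
    refine ff_dn cδ (by linarith) ?_
    intro c hc hδ
    by_contra hcon
    push Not at hcon
    have hc0 : 0 < c := by linarith [hc.1]
    have cc : ContinuousOn (fun s => v₂ s - v₁ s) (Icc c β) :=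
      (h₂.cv.mono (fun x hx => ⟨by linarith [hx.1], by linarith [hx.2]⟩)).sub
        (h₁.cv.mono (fun x hx => ⟨by linarith [hx.1], by linarith [hx.2]⟩))
    have hge0 : 0 ≤ ρ₂ c - ρ₁ c := by
      have h1 : ContinuousWithinAt (fun s => ρ₂ s - ρ₁ s) (Ioc c β) c :=
        (cδ c ⟨hc.1, hc.2.le⟩).mono (fun x hx => ⟨hc.1.trans hx.1.le, hx.2⟩)
      have : (nhdsWithin c (Ioc c β)).NeBot := by
        rw [nhdsWithin_Ioc_eq_nhdsGT hc.2]; infer_instance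
      exact ge_of_tendsto h1 (eventually_nhdsWithin_of_forall fun x hx => (hδ x hx).le)
    have hvv : ∀ s ∈ Icc c β, 0 < v₂ s - v₁ s := by
      refine ff_dn cc (hv β ⟨le_rfl, hM₁.le⟩) ?_
      intro x hx hvx
      by_contra hcon2
      push Not at hcon2
      have hx0 : 0 < x := hc0.trans_le hx.1
      have hge : 0 ≤ v₂ x - v₁ x := by
        have h1 : ContinuousWithinAt (fun s => v₂ s - v₁ s) (Ioc x β) x :=
          (cc x ⟨hx.1, hx.2.le⟩).mono (fun z hz => ⟨hx.1.trans hz.1.le, hz.2⟩)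
        have : (nhdsWithin x (Ioc x β)).NeBot := by
          rw [nhdsWithin_Ioc_eq_nhdsGT hx.2]; infer_instance
        exact ge_of_tendsto h1 (eventually_nhdsWithin_of_forall fun x hx => (hvx x hx).le)
      have heq : v₁ x = v₂ x := by linarith
      rcases eq_or_lt_of_le hx.1 with h | h
      · have hr : ρ₁ x = ρ₂ x := by rw [← h]; linarith
        exact huniq x ⟨hx0, by linarith [hx.2]⟩ ⟨hr, heq⟩
      · have := hδ x ⟨h, hx.2.le⟩
        exact dn_cross N h₁ h₂ hM hx0 hx.2 hM₁.le hvx heq (by linarith)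
    have hr : ρ₁ c = ρ₂ c := by linarith
    refine dn_W N h₁ h₂ hM₁ hM hc0 hc.2.le hr.ge ?_
    have v1 := h₁.vpos c ⟨hc0, by linarith [hc.2]⟩
    have e1 := h₁.E c ⟨hc0, by linarith [hc.2]⟩
    have p2 := h₂.ρpos (s := c) ⟨hc0, by linarith [hc.2]⟩
    have := hvv c ⟨le_rfl, hc.2.le⟩
    rw [hr]
    apply mul_lt_mul_of_pos_left _ p2
    apply Real.sqrt_lt_sqrt e1.le
    nlinarith
  intro s hs
  rcases le_total s β with h | h
  · have := hlo s ⟨hs.1, h⟩; linarith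
  · exact hup s ⟨h, hs.2⟩

end partD

section partE
/-- positive solution, regular up to the boundary -/
structure Sol (k : ℕ) (f : ℝ → ℝ) (a : ℝ) (u w : ℝ → ℝ) : Prop where
  ha : 0 < a
  cu : ContinuousOn u (Ici a)
  cw : ContinuousOn w (Ici a)
  du : ∀ r, a < r → HasDerivAt u (w r) r
  dw : ∀ r, a < r → HasDerivAt w (-((k : ℝ) / r * w r + f (u r))) r
  ua : u a = 0
  upos : ∀ r, a < r → 0 < u r
  lim : Tendsto u atTop (nhds 0)

section sol
variable {k : ℕ} {f F m' : ℝ → ℝ} {β a : ℝ} {u w : ℝ → ℝ}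

lemma Sol.unn (h : Sol k f a u w) {r : ℝ} (hr : a ≤ r) : 0 ≤ u r := by
  rcases eq_or_lt_of_le hr with e | e
  · rw [← e, h.ua]
  · exact (h.upos r e).le

lemma Sol.dE (h : Sol k f a u w) (N : Nl k f F m' β) {r : ℝ} (hr : a < r) :
    HasDerivAt (fun r => w r ^ 2 + 2 * F (u r)) (-(2 * (k / r) * w r ^ 2)) r := by
  have h1 := ((h.dw r hr).pow 2).add (((N.dF (u r) (h.upos r hr)).comp r (h.du r hr)).const_mul 2)
  refine h1.congr_deriv ?_
  push_cast
  ring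

lemma Sol.cE (h : Sol k f a u w) (N : Nl k f F m' β) :
    ContinuousOn (fun r => w r ^ 2 + 2 * F (u r)) (Ici a) :=
  (h.cw.pow 2).add (continuousOn_const.mul (N.contF.comp h.cu (fun _ hr => h.unn hr)))

lemma Sol.Eanti (h : Sol k f a u w) (N : Nl k f F m' β) {r s : ℝ} (hr : a ≤ r) (hs : r ≤ s) :
    w s ^ 2 + 2 * F (u s) ≤ w r ^ 2 + 2 * F (u r) := by
  refine ax_anti (g := fun r => w r ^ 2 + 2 * F (u r)) hs
    ((h.cE N).mono (fun x hx => hr.trans hx.1)) (fun x hx => h.dE N (hr.trans_lt hx.1)) ?_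
  intro x hx
  have : 0 < x := h.ha.trans (hr.trans_lt hx.1)
  have : 0 ≤ 2 * ((k:ℝ) / x) * w x ^ 2 := by positivity
  linarith

lemma Sol.limF (h : Sol k f a u w) (N : Nl k f F m' β) :
    Tendsto (fun r => 2 * F (u r)) atTop (nhds 0) := by
  have h1 : Tendsto u atTop (nhdsWithin 0 (Ici 0)) :=
    tendsto_nhdsWithin_iff.2 ⟨h.lim, (eventually_ge_atTop a).mono (fun r hr => h.unn hr)⟩
  have h2 : Tendsto F (nhdsWithin 0 (Ici 0)) (nhds (F 0)) := N.contF 0 self_mem_Ici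
  have := (h2.comp h1).const_mul 2
  rw [N.F0, mul_zero] at this
  exact this

lemma Sol.Enn (h : Sol k f a u w) (N : Nl k f F m' β) {r : ℝ} (hr : a ≤ r) :
    0 ≤ w r ^ 2 + 2 * F (u r) := by
  refine le_of_tendsto (h.limF N) ((eventually_ge_atTop r).mono (fun s hs => ?_))
  have := h.Eanti N hr hs
  nlinarith [sq_nonneg (w s)]

lemma Sol.Epos (h : Sol k f a u w) (N : Nl k f F m' β) {r : ℝ} (hr : a ≤ r) :
    0 < w r ^ 2 + 2 * F (u r) := by
  rcases eq_or_lt_of_le (h.Enn N hr) with e | e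
  · exfalso
    have hz : ∀ s, r ≤ s → w s ^ 2 + 2 * F (u s) = 0 := fun s hs =>
      le_antisymm ((h.Eanti N hr hs).trans e.ge) (h.Enn N (hr.trans hs))
    have hw : ∀ s, r < s → w s = 0 := by
      intro s hs
      have d1 := h.dE N (hr.trans_lt hs)
      have d2 : HasDerivAt (fun r => w r ^ 2 + 2 * F (u r)) 0 s := by
        refine (hasDerivAt_const s (0:ℝ)).congr_of_eventuallyEq ?_
        filter_upwards [Ioi_mem_nhds hs] with x hx
        exact hz x (le_of_lt hx)
      have d3 := d1.unique d2
      have hk : 0 < (k:ℝ) := by have := N.hk; exact_mod_cast this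
      have hs0 : 0 < s := h.ha.trans (hr.trans_lt hs)
      have : 0 < 2 * ((k:ℝ)/s) := by positivity
      have h5 : w s ^ 2 = 0 := by
        rcases mul_eq_zero.1 (neg_eq_zero.1 d3) with h6 | h6
        · linarith
        · exact h6
      exact pow_eq_zero_iff two_ne_zero |>.1 h5
    have hc : ∀ s, r + 1 ≤ s → u (r+1) ≤ u s := by
      intro s hs
      refine ax_mono hs (h.cu.mono (fun x hx => ?_)) (fun x hx => h.du x ?_) (fun x hx => ?_)
      · show a ≤ x; linarith [hx.1]
      · linarith [hx.1]
      · rw [hw x (by linarith [hx.1])]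
    have : u (r+1) ≤ 0 := ge_of_tendsto h.lim ((eventually_ge_atTop (r+1)).mono hc)
    have := h.upos (r+1) (by linarith)
    linarith
  · exact e

lemma Sol.crit (h : Sol k f a u w) (N : Nl k f F m' β) {r : ℝ} (hr : a ≤ r) (hw : w r = 0) :
    β < u r := by
  have := h.Epos N hr
  rw [hw] at this
  by_contra hcon
  push Not at hcon
  have := N.Fneg (u r) ⟨h.unn hr, hcon⟩
  linarith

lemma Sol.wa (h : Sol k f a u w) (N : Nl k f F m' β) : 0 < w a := by
  by_contra hcon
  push Not at hcon
  rcases eq_or_lt_of_le hcon with e | e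
  · have := h.crit N le_rfl e
    rw [h.ua] at this
    linarith [N.hβ]
  · have h1 : ∀ᶠ x in nhdsWithin a (Ici a), w x < 0 :=
      (h.cw a self_mem_Ici).eventually (gt_mem_nhds e)
    obtain ⟨b, hb, hb2⟩ := (mem_nhdsGE_iff_exists_Ico_subset).1 h1
    have hab : a < (a+b)/2 := by have : a < b := hb; linarith
    have hbb : (a+b)/2 < b := by have : a < b := hb; linarith
    have := ax_anti hab.le (h.cu.mono (fun x hx => hx.1)) (fun x hx => h.du x hx.1)
      (fun x hx => (hb2 ⟨hx.1.le, hx.2.trans hbb⟩ : w x < 0).le)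
    rw [h.ua] at this
    linarith [h.upos _ hab]

lemma neg_der {g : ℝ → ℝ} {d c : ℝ} (h : HasDerivAt g d c) (hd : d < 0) (hc : g c = 0) :
    (∀ᶠ x in nhdsWithin c (Iio c), 0 < g x) ∧ (∀ᶠ x in nhdsWithin c (Ioi c), g x < 0) := by
  have h1 := (hasDerivAt_iff_tendsto_slope.1 h).eventually (gt_mem_nhds hd)
  constructor
  · have h2 := h1.filter_mono (nhdsWithin_mono c (fun x (hx : x < c) => ne_of_lt hx) :
      nhdsWithin c (Iio c) ≤ nhdsWithin c {c}ᶜ)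
    filter_upwards [h2, self_mem_nhdsWithin] with x hx hxc
    have hxc : x < c := hxc
    rw [slope_def_field, hc, sub_zero] at hx
    by_contra hcon
    push Not at hcon
    have := div_nonneg_of_nonpos hcon (by linarith : x - c ≤ 0)
    linarith
  · have h2 := h1.filter_mono (nhdsWithin_mono c (fun x (hx : c < x) => ne_of_gt hx) :
      nhdsWithin c (Ioi c) ≤ nhdsWithin c {c}ᶜ)
    filter_upwards [h2, self_mem_nhdsWithin] with x hx hxc
    have hxc : c < x := hxc
    rw [slope_def_field, hc, sub_zero] at hx
    by_contra hcon
    push Not at hcon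
    have := div_nonneg hcon (by linarith : 0 ≤ x - c)
    linarith

lemma Sol.dwneg (h : Sol k f a u w) (N : Nl k f F m' β) {r : ℝ} (hr : a < r) (hw : w r = 0) :
    HasDerivAt w (-(f (u r))) r ∧ -(f (u r)) < 0 := by
  have h1 := h.dw r hr
  rw [hw] at h1
  have := N.fpos (u r) (h.crit N hr.le hw).le
  refine ⟨h1.congr_deriv (by ring), by linarith⟩

lemma Sol.turn (h : Sol k f a u w) (N : Nl k f F m' β) : ∃ T, a < T ∧ w T = 0 ∧
    (∀ r, a ≤ r → r < T → 0 < w r) ∧ (∀ r, T < r → w r < 0) := by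
  have hwa := h.wa N
  have hex : ∃ r, a ≤ r ∧ w r ≤ 0 := by
    by_contra hcon
    push Not at hcon
    have hc : ∀ s, a + 1 ≤ s → u (a+1) ≤ u s := by
      intro s hs
      refine ax_mono hs (h.cu.mono (fun x hx => ?_)) (fun x hx => h.du x ?_) (fun x hx => ?_)
      · show a ≤ x; linarith [hx.1]
      · linarith [hx.1]
      · exact (hcon x (by linarith [hx.1])).le
    have : u (a+1) ≤ 0 := ge_of_tendsto h.lim ((eventually_ge_atTop (a+1)).mono hc)
    have := h.upos (a+1) (by linarith)
    linarith
  set Z : Set ℝ := Ici a ∩ w ⁻¹' (Iic 0) with hZ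
  have hZc : IsClosed Z := h.cw.preimage_isClosed_of_isClosed isClosed_Ici isClosed_Iic
  have hZn : Z.Nonempty := hex
  have hZb : BddBelow Z := ⟨a, fun y hy => hy.1⟩
  have hm := hZc.csInf_mem hZn hZb
  set T := sInf Z
  have haT : a < T := by
    rcases eq_or_lt_of_le (show a ≤ T from hm.1) with e | e
    · have h2 : w T ≤ 0 := hm.2
      rw [← e] at h2; linarith
    · exact e
  have hpos : ∀ r, a ≤ r → r < T → 0 < w r := by
    intro r hr hrT
    by_contra hcon
    push Not at hcon
    have : T ≤ r := csInf_le hZb ⟨hr, hcon⟩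
    linarith
  have hT0 : w T = 0 := by
    refine le_antisymm hm.2 ?_
    have h1 : Tendsto w (nhdsWithin T (Iio T)) (nhds (w T)) :=
      ((h.dw T haT).continuousAt.tendsto).mono_left nhdsWithin_le_nhds
    refine ge_of_tendsto h1 ?_
    filter_upwards [Ioo_mem_nhdsLT haT] with x hx
    exact (hpos x hx.1.le hx.2).le
  refine ⟨T, haT, hT0, hpos, ?_⟩
  intro b hb
  obtain ⟨d1, d2⟩ := h.dwneg N haT hT0
  obtain ⟨x, hx1, hx2⟩ := ((neg_der d1 d2 hT0).2.and (Ioo_mem_nhdsGT hb)).exists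
  have := ff_up (g := fun r => - w r) (a := x) (b := b)
    (h.cw.mono (fun y hy => by show a ≤ y; linarith [hy.1, hx2.1])).neg (by linarith) (by
      intro c hc hlt
      by_contra hcon
      push Not at hcon
      have hac : a < c := by linarith [hc.1, hx2.1]
      have hle : w c ≤ 0 := by
        have h1 : Tendsto w (nhdsWithin c (Iio c)) (nhds (w c)) :=
          ((h.dw c hac).continuousAt.tendsto).mono_left nhdsWithin_le_nhds
        refine le_of_tendsto h1 ?_
        filter_upwards [Ioo_mem_nhdsLT hc.1] with y hy
        linarith [hlt y ⟨hy.1.le, hy.2⟩]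
      have h0 : w c = 0 := by linarith
      obtain ⟨d1, d2⟩ := h.dwneg N hac h0
      obtain ⟨y, hy1, hy2⟩ := ((neg_der d1 d2 h0).1.and (Ioo_mem_nhdsLT hc.1)).exists
      linarith [hlt y ⟨hy2.1.le, hy2.2⟩]) b ⟨hx2.2.le, le_rfl⟩
  linarith

lemma inv_cont {g τ : ℝ → ℝ} {K S : Set ℝ} (hK : IsCompact K) (hg : ContinuousOn g K)
    (hi : InjOn g K) (hτ : ∀ s ∈ S, τ s ∈ K) (hgτ : ∀ s ∈ S, g (τ s) = s) :
    ContinuousOn τ S := by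
  rw [continuousOn_iff_isClosed]
  intro t ht
  refine ⟨g '' (K ∩ t), ((hK.inter_right ht).image_of_continuousOn
    (hg.mono inter_subset_left)).isClosed, ?_⟩
  ext s
  constructor
  · rintro ⟨h1, h2⟩
    exact ⟨⟨τ s, ⟨hτ s h2, h1⟩, hgτ s h2⟩, h2⟩
  · rintro ⟨⟨x, ⟨hx1, hx2⟩, hx3⟩, h2⟩
    refine ⟨?_, h2⟩
    have : τ s = x := hi (hτ s h2) hx1 (by rw [hgτ s h2, hx3])
    show τ s ∈ t
    rw [this]; exact hx2

lemma Sol.up (h : Sol k f a u w) (N : Nl k f F m' β) {T : ℝ} (haT : a < T) (hT : w T = 0)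
    (hpos : ∀ r, a ≤ r → r < T → 0 < w r) :
    ∃ τ : ℝ → ℝ, UpBr k f F a (u T) T τ (fun s => w (τ s)) ∧
      (∀ s ∈ Icc 0 (u T), τ s ∈ Icc a T ∧ u (τ s) = s) ∧ StrictMonoOn u (Icc a T) := by
  have hcu : ContinuousOn u (Icc a T) := h.cu.mono (fun x hx => hx.1)
  have hsm : StrictMonoOn u (Icc a T) := by
    intro x hx y hy hxy
    exact ax_smono hxy (h.cu.mono (fun z hz => hx.1.trans hz.1))
      (fun z hz => h.du z (hx.1.trans_lt hz.1))
      (fun z hz => hpos z (hx.1.trans hz.1.le) (hz.2.trans_le hy.2))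
  have hex : ∀ s ∈ Icc 0 (u T), ∃ r ∈ Icc a T, u r = s := by
    intro s hs
    have := intermediate_value_Icc haT.le hcu
    rw [h.ua] at this
    exact this hs
  have hM : 0 < u T := h.upos T haT
  set τ := fun s => Function.invFunOn u (Icc a T) s with hτ
  have hm : ∀ s ∈ Icc 0 (u T), τ s ∈ Icc a T := fun s hs => Function.invFunOn_mem (hex s hs)
  have hu : ∀ s ∈ Icc 0 (u T), u (τ s) = s := fun s hs => Function.invFunOn_eq (hex s hs)
  have hcτ : ContinuousOn τ (Icc 0 (u T)) := inv_cont isCompact_Icc hcu hsm.injOn hm hu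
  have h0 : τ 0 = a := hsm.injOn (hm 0 ⟨le_rfl, hM.le⟩) ⟨le_rfl, haT.le⟩
    (by rw [hu 0 ⟨le_rfl, hM.le⟩, h.ua])
  have hMM : τ (u T) = T := hsm.injOn (hm _ ⟨hM.le, le_rfl⟩) ⟨haT.le, le_rfl⟩
    (by rw [hu _ ⟨hM.le, le_rfl⟩])
  have hlt : ∀ s ∈ Ico 0 (u T), τ s < T := by
    intro s hs
    refine lt_of_le_of_ne (hm s ⟨hs.1, hs.2.le⟩).2 (fun e => ?_)
    have := hu s ⟨hs.1, hs.2.le⟩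
    rw [e] at this
    linarith [hs.2]
  have hgt : ∀ s ∈ Ioo 0 (u T), a < τ s := by
    intro s hs
    refine lt_of_le_of_ne (hm s ⟨hs.1.le, hs.2.le⟩).1 (fun e => ?_)
    have := hu s ⟨hs.1.le, hs.2.le⟩
    rw [← e, h.ua] at this
    linarith [hs.1]
  have hwp : ∀ s ∈ Ico 0 (u T), 0 < w (τ s) := fun s hs =>
    hpos _ (hm s ⟨hs.1, hs.2.le⟩).1 (hlt s hs)
  have hdτ : ∀ s ∈ Ioo 0 (u T), HasDerivAt τ (1 / w (τ s)) s := by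
    intro s hs
    have := HasDerivAt.of_local_left_inverse (f := u) (g := τ) (a := s)
      (hcτ.continuousAt (Icc_mem_nhds hs.1 hs.2)) (h.du _ (hgt s hs)) (hwp s ⟨hs.1.le, hs.2⟩).ne'
      (by filter_upwards [Icc_mem_nhds hs.1 hs.2] with y hy using hu y hy)
    rwa [one_div]
  refine ⟨τ, ⟨h.ha, hcτ, ?_, h0, hMM, ?_, hwp, fun s hs => (hm s hs).1, hdτ, ?_, ?_⟩,
    fun s hs => ⟨hm s hs, hu s hs⟩, hsm⟩
  · exact h.cw.comp hcτ (fun s hs => (hm s hs).1)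
  · simp only [hMM, hT]
  · intro s hs
    have := (h.dw _ (hgt s hs)).comp s (hdτ s hs)
    refine this.congr_deriv ?_
    have h1 := hwp s ⟨hs.1.le, hs.2⟩
    have h2 := h.ha.trans (hgt s hs)
    rw [hu s ⟨hs.1.le, hs.2.le⟩]
    field_simp
    ring
  · intro s hs
    have := h.Epos N (hm s hs).1
    rw [hu s hs] at this
    exact this

lemma Sol.dn (h : Sol k f a u w) (N : Nl k f F m' β) {T : ℝ} (haT : a < T) (hT : w T = 0)
    (hneg : ∀ r, T < r → w r < 0) :
    ∃ ρ : ℝ → ℝ, DnBr k f F (u T) T ρ (fun s => - w (ρ s)) ∧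
      (∀ s ∈ Ioc 0 (u T), T ≤ ρ s ∧ u (ρ s) = s) ∧ StrictAntiOn u (Ici T) := by
  have hTa : ∀ x, T ≤ x → a < x := fun x hx => haT.trans_le hx
  have hcu : ContinuousOn u (Ici T) := h.cu.mono (fun x hx => (hTa x hx).le)
  have hsm : StrictAntiOn u (Ici T) := by
    intro x hx y hy hxy
    exact ax_santi hxy (hcu.mono (fun z hz => le_trans hx hz.1))
      (fun z hz => h.du z (hTa z (le_trans hx hz.1.le)))
      (fun z hz => hneg z (lt_of_le_of_lt hx hz.1))
  have hM : 0 < u T := h.upos T haT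
  have hbig : ∀ s, 0 < s → ∃ R, T ≤ R ∧ u R < s := by
    intro s hs
    obtain ⟨R, h1, h2⟩ := ((h.lim.eventually (gt_mem_nhds hs)).and (eventually_ge_atTop T)).exists
    exact ⟨R, h2, h1⟩
  have hex : ∀ s ∈ Ioc 0 (u T), ∃ r ∈ Ici T, u r = s := by
    intro s hs
    obtain ⟨R, h1, h2⟩ := hbig s hs.1
    obtain ⟨r, hr, hr2⟩ := intermediate_value_Icc' h1 (hcu.mono (fun x hx => hx.1)) ⟨h2.le, hs.2⟩
    exact ⟨r, hr.1, hr2⟩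
  set ρ := fun s => Function.invFunOn u (Ici T) s with hρ
  have hm : ∀ s ∈ Ioc 0 (u T), T ≤ ρ s := fun s hs => Function.invFunOn_mem (hex s hs)
  have hu : ∀ s ∈ Ioc 0 (u T), u (ρ s) = s := fun s hs => Function.invFunOn_eq (hex s hs)
  have hcρ : ContinuousOn ρ (Ioc 0 (u T)) := by
    intro s hs
    have hs2 : 0 < s / 2 := by linarith [hs.1]
    obtain ⟨R, h1, h2⟩ := hbig (s/2) hs2
    have hle : ∀ z ∈ Icc (s/2) (u T), ρ z ∈ Icc T R := by
      intro z hz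
      have hz0 : z ∈ Ioc 0 (u T) := ⟨hs2.trans_le hz.1, hz.2⟩
      refine ⟨hm z hz0, ?_⟩
      by_contra hcon
      push Not at hcon
      have := hsm h1 (hm z hz0) hcon
      rw [hu z hz0] at this
      linarith [hz.1]
    have := inv_cont (g := u) (τ := ρ) (S := Icc (s/2) (u T)) (isCompact_Icc (a := T) (b := R))
      (hcu.mono (fun x hx => hx.1)) (hsm.injOn.mono (fun x hx => hx.1)) hle
      (fun z hz => hu z ⟨hs2.trans_le hz.1, hz.2⟩)
    refine (this s ⟨by linarith, hs.2⟩).mono_of_mem_nhdsWithin ?_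
    filter_upwards [self_mem_nhdsWithin, mem_nhdsWithin_of_mem_nhds
      (Ioi_mem_nhds (by linarith [hs.1] : s/2 < s))] with z h1 h2
    exact ⟨le_of_lt h2, h1.2⟩
  have hMM : ρ (u T) = T := hsm.injOn (hm _ ⟨hM, le_rfl⟩) (self_mem_Ici)
    (by rw [hu _ ⟨hM, le_rfl⟩])
  have hlt : ∀ s ∈ Ioo 0 (u T), T < ρ s := by
    intro s hs
    refine lt_of_le_of_ne (hm s ⟨hs.1, hs.2.le⟩) (fun e => ?_)
    have := hu s ⟨hs.1, hs.2.le⟩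
    rw [← e] at this
    linarith [hs.2]
  have hwp : ∀ s ∈ Ioo 0 (u T), 0 < - w (ρ s) := fun s hs => by
    linarith [hneg _ (hlt s hs)]
  have hdρ : ∀ s ∈ Ioo 0 (u T), HasDerivAt ρ (-(1 / (- w (ρ s)))) s := by
    intro s hs
    have := HasDerivAt.of_local_left_inverse (f := u) (g := ρ) (a := s)
      (hcρ.continuousAt (Ioc_mem_nhds hs.1 hs.2)) (h.du _ (hTa _ (hlt s hs).le))
      (by linarith [hwp s hs] : w (ρ s) < 0).ne
      (by filter_upwards [Ioc_mem_nhds hs.1 hs.2] with y hy using hu y hy)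
    refine this.congr_deriv ?_
    rw [one_div, inv_neg, neg_neg]
  refine ⟨ρ, ⟨h.ha.trans haT, hcρ, ?_, hMM, ?_, hwp, hm, hdρ, ?_, ?_, ?_⟩,
    fun s hs => ⟨hm s hs, hu s hs⟩, hsm⟩
  · exact (h.cw.comp hcρ (fun s hs => (hTa _ (hm s hs)).le)).neg
  · simp only [hMM, hT, neg_zero]
  · intro s hs
    have := ((h.dw _ (hTa _ (hlt s hs).le)).comp s (hdρ s hs)).neg
    refine this.congr_deriv ?_
    have h1 := hwp s hs
    have h2 := h.ha.trans (hTa _ (hlt s hs).le)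
    rw [hu s ⟨hs.1, hs.2.le⟩]
    have h3 : w (ρ s) ≠ 0 := by linarith
    field_simp
    ring
  · intro s hs
    have := h.Epos N (hTa _ (hm s hs)).le
    rw [hu s hs] at this
    rw [neg_sq]
    exact this
  · rw [tendsto_atTop]
    intro B
    have hB : 0 < u (max B T) := h.upos _ (hTa _ (le_max_right _ _))
    filter_upwards [Ioo_mem_nhdsGT (lt_min hB hM)] with s hs
    by_contra hcon
    push Not at hcon
    have hs0 : s ∈ Ioc 0 (u T) := ⟨hs.1, (hs.2.trans_le (min_le_right _ _)).le⟩
    have := hsm.antitoneOn (hm s hs0) (le_max_right B T) (hcon.le.trans (le_max_left _ _))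
    rw [hu s hs0] at this
    linarith [hs.2, min_le_left (u (max B T)) (u T)]

end sol

end partE

section partF
section two
variable {k : ℕ} {f F m' : ℝ → ℝ} {β a : ℝ} {u₁ w₁ u₂ w₂ : ℝ → ℝ}

set_option maxHeartbeats 1000000 in
lemma sol_unique (hlip : ∀ C : ℝ, ∃ L : ℝ, 0 ≤ L ∧ ∀ s ∈ Icc 0 C, ∀ t ∈ Icc 0 C,
      |f s - f t| ≤ L * |s - t|)
    (h₁ : Sol k f a u₁ w₁) (h₂ : Sol k f a u₂ w₂) {c : ℝ} (hc : a ≤ c)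
    (hu : u₁ c = u₂ c) (hw : w₁ c = w₂ c) : ∀ r, a ≤ r → u₁ r = u₂ r ∧ w₁ r = w₂ r := by
  intro r hr
  set b := max c r with hb
  have sub : Icc a b ⊆ Ici a := fun x hx => hx.1
  obtain ⟨C₁, hC₁⟩ := isCompact_Icc.exists_bound_of_continuousOn (h₁.cu.mono sub)
  obtain ⟨C₂, hC₂⟩ := isCompact_Icc.exists_bound_of_continuousOn (h₂.cu.mono sub)
  obtain ⟨L, hL0, hL⟩ := hlip (max C₁ C₂)
  have hLf : ∀ x ∈ Icc a b, |f (u₂ x) - f (u₁ x)| ≤ L * |u₂ x - u₁ x| := by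
    intro x hx
    apply hL
    · exact ⟨h₂.unn hx.1, (le_abs_self _).trans ((hC₂ x hx).trans (le_max_right _ _))⟩
    · exact ⟨h₁.unn hx.1, (le_abs_self _).trans ((hC₁ x hx).trans (le_max_left _ _))⟩
  set h : ℝ → ℝ := fun x => (u₂ x - u₁ x) ^ 2 + (w₂ x - w₁ x) ^ 2 with hh
  set h' : ℝ → ℝ := fun x => 2 * (u₂ x - u₁ x) * (w₂ x - w₁ x) + 2 * (w₂ x - w₁ x) *
    (-((k : ℝ) / x * w₂ x + f (u₂ x)) - -((k : ℝ) / x * w₁ x + f (u₁ x))) with hh'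
  have ch : ContinuousOn h (Ici a) := ((h₂.cu.sub h₁.cu).pow 2).add ((h₂.cw.sub h₁.cw).pow 2)
  have dh : ∀ x, a < x → HasDerivAt h (h' x) x := by
    intro x hx
    have := (((h₂.du x hx).sub (h₁.du x hx)).pow 2).add (((h₂.dw x hx).sub (h₁.dw x hx)).pow 2)
    refine this.congr_deriv ?_
    simp only [hh', Pi.sub_apply]
    push_cast
    ring
  set K : ℝ := 1 + L + 2 * ((k : ℝ) / a) with hK
  have ha := h₁.ha
  have bd : ∀ x ∈ Ioo a b, |h' x| ≤ K * h x := by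
    intro x hx
    have hl := hLf x ⟨hx.1.le, hx.2.le⟩
    have hx0 : 0 < x := ha.trans hx.1
    set X := u₂ x - u₁ x with hX
    set Y := w₂ x - w₁ x with hY
    set D := f (u₂ x) - f (u₁ x) with hD
    have e : h' x = 2 * X * Y - 2 * ((k:ℝ) / x) * Y ^ 2 - 2 * Y * D := by
      simp only [hh', hX, hY, hD]; ring
    have e2 : h x = X ^ 2 + Y ^ 2 := rfl
    rw [e, e2]
    have hka : (k:ℝ) / x ≤ k / a := by
      have := hx.1
      gcongr
    have hk0 : 0 ≤ (k:ℝ) / x := by positivity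
    have t1 : |2 * X * Y| ≤ X ^ 2 + Y ^ 2 := by
      rw [abs_le]; constructor <;> nlinarith [sq_nonneg (X + Y), sq_nonneg (X - Y)]
    have t2 : |2 * ((k:ℝ) / x) * Y ^ 2| ≤ 2 * ((k:ℝ) / a) * (X ^ 2 + Y ^ 2) := by
      rw [abs_of_nonneg (by positivity)]
      have : Y ^ 2 ≤ X ^ 2 + Y ^ 2 := by nlinarith [sq_nonneg X]
      gcongr
    have t3 : |2 * Y * D| ≤ L * (X ^ 2 + Y ^ 2) := by
      rw [abs_mul, abs_mul, abs_two]
      have : |Y| * |D| ≤ |Y| * (L * |X|) := by gcongr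
      have q : 2 * (|Y| * |X|) ≤ X ^ 2 + Y ^ 2 := by
        rw [← sq_abs X, ← sq_abs Y]; nlinarith [sq_nonneg (|X| - |Y|)]
      nlinarith
    calc |2 * X * Y - 2 * ((k:ℝ) / x) * Y ^ 2 - 2 * Y * D|
        ≤ |2 * X * Y| + |2 * ((k:ℝ) / x) * Y ^ 2| + |2 * Y * D| := by
          have q1 := abs_sub (2 * X * Y - 2 * ((k:ℝ) / x) * Y ^ 2) (2 * Y * D)
          have q2 := abs_sub (2 * X * Y) (2 * ((k:ℝ) / x) * Y ^ 2)
          linarith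
      _ ≤ K * (X ^ 2 + Y ^ 2) := by rw [hK]; linarith
  have hc0 : h c = 0 := by simp only [hh, hu, hw]; ring
  have hr0 : h r ≤ 0 := by
    rcases le_total c r with hcr | hrc
    · have := ax_anti (g := fun x => h x * Real.exp (-K * x))
        (g' := fun x => h' x * Real.exp (-K * x) + h x * (Real.exp (-K * x) * (-K * 1))) hcr
        ((ch.mono (fun x hx => hc.trans hx.1)).mul (by fun_prop))
        (fun x hx => (dh x (hc.trans_lt hx.1)).mul (((hasDerivAt_id x).const_mul (-K)).exp)) (by
          intro x hx
          have := (abs_le.1 (bd x ⟨hc.trans_lt hx.1, hx.2.trans_le (le_max_right _ _)⟩)).2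
          have e := Real.exp_pos (-K * x)
          nlinarith)
      rw [hc0, zero_mul] at this
      by_contra hcon
      push Not at hcon
      have := mul_pos hcon (Real.exp_pos (-K * r))
      linarith
    · have := ax_mono (g := fun x => h x * Real.exp (K * x))
        (g' := fun x => h' x * Real.exp (K * x) + h x * (Real.exp (K * x) * (K * 1))) hrc
        ((ch.mono (fun x hx => hr.trans hx.1)).mul (by fun_prop))
        (fun x hx => (dh x (hr.trans_lt hx.1)).mul (((hasDerivAt_id x).const_mul K).exp)) (by
          intro x hx
          have := (abs_le.1 (bd x ⟨hr.trans_lt hx.1, hx.2.trans_le (le_max_left _ _)⟩)).1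
          have e := Real.exp_pos (K * x)
          nlinarith)
      rw [hc0, zero_mul] at this
      by_contra hcon
      push Not at hcon
      have := mul_pos hcon (Real.exp_pos (K * r))
      linarith
  have e2 : h r = (u₂ r - u₁ r) ^ 2 + (w₂ r - w₁ r) ^ 2 := rfl
  rw [e2] at hr0
  have x1 : (u₂ r - u₁ r) ^ 2 = 0 := by
    linarith only [hr0, sq_nonneg (u₂ r - u₁ r), sq_nonneg (w₂ r - w₁ r)]
  have x2 : (w₂ r - w₁ r) ^ 2 = 0 := by
    linarith only [hr0, sq_nonneg (u₂ r - u₁ r), sq_nonneg (w₂ r - w₁ r)]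
  have x3 := pow_eq_zero_iff two_ne_zero |>.1 x1
  have x4 := pow_eq_zero_iff two_ne_zero |>.1 x2
  constructor <;> linarith only [x3, x4]

lemma wronski (h₁ : Sol k f a u₁ w₁) (h₂ : Sol k f a u₂ w₂)
    (hsup : ∀ s t : ℝ, 1 ≤ s → s < t → (t - 1) * f s ≤ (s - 1) * f t)
    {A B : ℝ} (hA : a < A) (hAB : A < B) (hu1 : ∀ r ∈ Icc A B, 1 ≤ u₁ r)
    (hu2 : ∀ r ∈ Icc A B, u₁ r < u₂ r) (hA1 : u₁ A = 1) (hB1 : u₁ B = 1)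
    (hwA : 0 < w₁ A) (hwB : w₁ B < 0) : False := by
  have sub : Icc A B ⊆ Ici a := fun x hx => hA.le.trans hx.1
  have := ax_mono (g := fun r => r ^ k * ((u₂ r - 1) * w₁ r - w₂ r * (u₁ r - 1)))
    (g' := fun r => r ^ k * ((u₁ r - 1) * f (u₂ r) - (u₂ r - 1) * f (u₁ r))) hAB.le
    ((continuousOn_id.pow k).mul ((((h₂.cu.mono sub).sub continuousOn_const).mul
      (h₁.cw.mono sub)).sub ((h₂.cw.mono sub).mul ((h₁.cu.mono sub).sub continuousOn_const))))
    (fun x hx => by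
      have hx0 := hA.trans hx.1
      have hxp := h₁.ha.trans hx0
      have := (hasDerivAt_pow k x).mul ((((h₂.du x hx0).sub_const 1).mul (h₁.dw x hx0)).sub
        ((h₂.dw x hx0).mul ((h₁.du x hx0).sub_const 1)))
      refine this.congr_deriv ?_
      simp only [Pi.sub_apply, Pi.mul_apply]
      rcases Nat.eq_zero_or_pos k with h0 | h0
      · subst h0; simp; ring
      · obtain ⟨j, rfl⟩ : ∃ j, k = j + 1 := ⟨k - 1, by lia⟩
        simp only [Nat.add_sub_cancel]
        field_simp
        ring)
    (fun x hx => by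
      have hx' : x ∈ Icc A B := ⟨hx.1.le, hx.2.le⟩
      have := hsup _ _ (hu1 x hx') (hu2 x hx')
      have hxp := h₁.ha.trans (hA.trans hx.1)
      exact mul_nonneg (by positivity) (by linarith))
  rw [hA1, hB1] at this
  have hA0 : 0 < A := h₁.ha.trans hA
  have hB0 : 0 < B := hA0.trans hAB
  have uA := hu2 A ⟨le_rfl, hAB.le⟩
  have uB := hu2 B ⟨hAB.le, le_rfl⟩
  rw [hA1] at uA; rw [hB1] at uB
  have p1 : 0 < A ^ k * ((u₂ A - 1) * w₁ A) := mul_pos (by positivity) (mul_pos (by linarith) hwA)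
  have p2 : B ^ k * ((u₂ B - 1) * w₁ B) < 0 :=
    mul_neg_of_pos_of_neg (by positivity) (mul_neg_of_pos_of_neg (by linarith) hwB)
  simp only [sub_self, mul_zero, sub_zero] at this
  linarith

lemma no_lt (N : Nl k f F m' β) (hlip : ∀ C : ℝ, ∃ L : ℝ, 0 ≤ L ∧ ∀ s ∈ Icc 0 C, ∀ t ∈ Icc 0 C,
      |f s - f t| ≤ L * |s - t|)
    (hsup : ∀ s t : ℝ, 1 ≤ s → s < t → (t - 1) * f s ≤ (s - 1) * f t)
    (h₁ : Sol k f a u₁ w₁) (h₂ : Sol k f a u₂ w₂) (hlt : w₁ a < w₂ a) : False := by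
  have hβ := N.hβ
  obtain ⟨T₁, haT₁, hT₁, hp₁, hn₁⟩ := h₁.turn N
  obtain ⟨T₂, haT₂, hT₂, hp₂, hn₂⟩ := h₂.turn N
  obtain ⟨τ₁, U₁, hτ₁, sm₁⟩ := h₁.up N haT₁ hT₁ hp₁
  obtain ⟨τ₂, U₂, hτ₂, sm₂⟩ := h₂.up N haT₂ hT₂ hp₂
  obtain ⟨ρ₁, D₁, hρ₁, sa₁⟩ := h₁.dn N haT₁ hT₁ hn₁
  obtain ⟨ρ₂, D₂, hρ₂, sa₂⟩ := h₂.dn N haT₂ hT₂ hn₂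
  have hM₁ := h₁.crit N haT₁.le hT₁
  have hM₂ := h₂.crit N haT₂.le hT₂
  have h0 : w₁ (τ₁ 0) < w₂ (τ₂ 0) := by rw [U₁.τ0, U₂.τ0]; exact hlt
  have hM := up_M N U₁ U₂ hM₁ hM₂ h0
  have hP2 := (U₂.Panti N hM₁.le hM.le).trans_lt (up_P N U₁ U₂ hM₁ hM₂ h0)
  have huniq : ∀ s ∈ Ioo 0 (u₁ T₁), ¬ (ρ₁ s = ρ₂ s ∧ - w₁ (ρ₁ s) = - w₂ (ρ₂ s)) := by
    rintro s hs ⟨e1, e2⟩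
    have q1 := hρ₁ s ⟨hs.1, hs.2.le⟩
    have q2 := hρ₂ s ⟨hs.1, (hs.2.trans hM).le⟩
    have := (sol_unique hlip h₁ h₂ (c := ρ₁ s) (haT₁.le.trans q1.1)
      (by rw [q1.2, e1, q2.2]) (by rw [← e1] at e2; linarith) a le_rfl).2
    linarith
  have hρ := dn_main N D₁ D₂ hM₁ hM hP2 huniq
  have hV := up_V N U₁ U₂ h0 le_rfl hM.le
  have hτ : ∀ s ∈ Icc 1 (u₁ T₁), τ₂ s < τ₁ s := fun s hs =>
    up_tau U₁ U₂ (by linarith [hs.1]) hs.2 (hs.2.trans hM.le)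
      (fun x hx => hV x ⟨hx.1, hx.2.le.trans hs.2⟩)
  have one1 : (1:ℝ) ∈ Icc 1 (u₁ T₁) := ⟨le_rfl, by linarith⟩
  have one2 : (1:ℝ) ∈ Icc 0 (u₁ T₁) := ⟨by norm_num, by linarith⟩
  have one3 : (1:ℝ) ∈ Ioc 0 (u₁ T₁) := ⟨by norm_num, by linarith⟩
  -- u₂ > s strictly between τ₂ s and ρ₂ s
  have betw : ∀ s ∈ Icc 1 (u₁ T₁), ∀ r, τ₂ s < r → r < ρ₂ s → s < u₂ r := by
    intro s hs r hr1 hr2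
    have q1 := hτ₂ s ⟨by linarith [hs.1], hs.2.trans hM.le⟩
    have q2 := hρ₂ s ⟨by linarith [hs.1], hs.2.trans hM.le⟩
    rcases le_total r T₂ with h | h
    · have := sm₂ q1.1 ⟨q1.1.1.trans hr1.le, h⟩ hr1
      rwa [q1.2] at this
    · have := sa₂ h q2.1 hr2
      rwa [q2.2] at this
  have a1 := hτ₁ 1 one2
  have b1 := hρ₁ 1 one3
  have hA : a < τ₁ 1 := by
    refine lt_of_le_of_ne a1.1.1 (fun e => ?_)
    have := a1.2
    rw [← e, h₁.ua] at this
    norm_num at this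
  have hAT : τ₁ 1 < T₁ := by
    refine lt_of_le_of_ne a1.1.2 (fun e => ?_)
    have := a1.2
    rw [e] at this
    linarith
  have hTB : T₁ < ρ₁ 1 := by
    refine lt_of_le_of_ne b1.1 (fun e => ?_)
    have := b1.2
    rw [← e] at this
    linarith
  have hmain : ∀ r ∈ Icc (τ₁ 1) (ρ₁ 1), 1 ≤ u₁ r ∧ u₁ r < u₂ r := by
    intro r hr
    rcases le_total r T₁ with h | h
    · have hra : r ∈ Icc a T₁ := ⟨hA.le.trans hr.1, h⟩
      have x1 : 1 ≤ u₁ r := by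
        have := sm₁.monotoneOn a1.1 hra hr.1
        rwa [a1.2] at this
      have x2 : u₁ r ≤ u₁ T₁ := sm₁.monotoneOn hra ⟨haT₁.le, le_rfl⟩ h
      refine ⟨x1, betw _ ⟨x1, x2⟩ r ?_ ?_⟩
      · have q := hτ₁ (u₁ r) ⟨by linarith, x2⟩
        have : τ₁ (u₁ r) = r := sm₁.injOn q.1 hra q.2
        have := hτ _ ⟨x1, x2⟩
        linarith
      · have q := hρ₁ (u₁ r) ⟨by linarith, x2⟩
        have := hρ _ ⟨x1, x2⟩
        linarith [q.1]
    · have x1 : 1 ≤ u₁ r := by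
        have := sa₁.antitoneOn h b1.1 hr.2
        rwa [b1.2] at this
      have x2 : u₁ r ≤ u₁ T₁ := sa₁.antitoneOn (self_mem_Ici) h h
      refine ⟨x1, betw _ ⟨x1, x2⟩ r ?_ ?_⟩
      · have q := hτ₁ (u₁ r) ⟨by linarith, x2⟩
        have := hτ _ ⟨x1, x2⟩
        linarith [q.1.2]
      · have q := hρ₁ (u₁ r) ⟨by linarith, x2⟩
        have : ρ₁ (u₁ r) = r := sa₁.injOn q.1 h q.2
        have := hρ _ ⟨x1, x2⟩
        linarith
  exact wronski h₁ h₂ hsup hA (hAT.trans hTB) (fun r hr => (hmain r hr).1)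
    (fun r hr => (hmain r hr).2) a1.2 b1.2 (hp₁ _ hA.le hAT) (hn₁ _ hTB)

theorem abs_unique (N : Nl k f F m' β)
    (hlip : ∀ C : ℝ, ∃ L : ℝ, 0 ≤ L ∧ ∀ s ∈ Icc 0 C, ∀ t ∈ Icc 0 C,
      |f s - f t| ≤ L * |s - t|)
    (hsup : ∀ s t : ℝ, 1 ≤ s → s < t → (t - 1) * f s ≤ (s - 1) * f t)
    (h₁ : Sol k f a u₁ w₁) (h₂ : Sol k f a u₂ w₂) : ∀ r, a ≤ r → u₁ r = u₂ r := by
  rcases lt_trichotomy (w₁ a) (w₂ a) with h | h | h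
  · exact (no_lt N hlip hsup h₁ h₂ h).elim
  · exact fun r hr => (sol_unique hlip h₁ h₂ le_rfl (by rw [h₁.ua, h₂.ua]) h r hr).1
  · exact (no_lt N hlip hsup h₂ h₁ h).elim

end two

end partF

section partG
lemma quad_nonneg {A B C x y : ℝ} (hA : 0 ≤ A) (hC : 0 < C) (hx : 0 ≤ x) (hy : 0 ≤ y)
    (h : 0 ≤ B ∨ B ^ 2 ≤ 4 * A * C) : 0 ≤ A * x ^ 2 + B * y * x + C * y ^ 2 := by
  rcases h with h | h
  · positivity
  · have : 0 ≤ 4 * C * (A * x ^ 2 + B * y * x + C * y ^ 2) := by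
      have e : 4 * C * (A * x ^ 2 + B * y * x + C * y ^ 2) =
        (2 * C * y + B * x) ^ 2 + (4 * A * C - B ^ 2) * x ^ 2 := by ring
      rw [e]
      have := sub_nonneg.2 h
      positivity
    exact nonneg_of_mul_nonneg_right this (by positivity)

lemma poly_ineq {n p q t : ℝ} (hn : 2 ≤ n) (hq : 0 < q) (hqp : q < p)
    (ht : (p + 1) / (q + 1) ≤ t)
    (hc : ((n - 2) * p ≤ n + 2 ∧ n * q ≤ 2 * p + 2) ∨
      n * (p + q + 1) ^ 2 ≤ 2 * (n + 2) * (p + 1) * (q + 1)) :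
    2 * n * ((t / (p + 1) - 1 / (q + 1)) * (p * t - q)) ≤ (n + 2) * (t - 1) ^ 2 := by
  have hp : 0 < p := hq.trans hqp
  obtain ⟨x, hx0, rfl⟩ : ∃ x, 0 ≤ x ∧ t = (1 + x) * (p + 1) / (q + 1) := by
    refine ⟨t * (q + 1) / (p + 1) - 1, ?_, by field_simp; ring⟩
    rw [sub_nonneg, le_div_iff₀ (by linarith)]
    rw [div_le_iff₀ (by linarith)] at ht
    linarith
  have key : 0 ≤ ((p + 1) * ((n + 2) - (n - 2) * p)) * x ^ 2 +
      (2 * (2 * p + 2 - n * q)) * (p - q) * x + (n + 2) * (p - q) ^ 2 := by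
    have hD : n * (p + q + 1) ^ 2 ≤ 2 * (n + 2) * (p + 1) * (q + 1) →
        (2 * (2 * p + 2 - n * q)) ^ 2 ≤ 4 * ((p + 1) * ((n + 2) - (n - 2) * p)) * (n + 2) := by
      intro h
      have := mul_le_mul_of_nonneg_left h (by linarith : 0 ≤ 4 * n)
      nlinarith
    apply quad_nonneg _ (by linarith) hx0 (by linarith)
    · rcases hc with h | h
      · left; linarith [h.2]
      · right; exact hD h
    · rcases hc with h | h
      · exact mul_nonneg (by linarith) (by linarith [h.1])
      · have h2 := hD h
        have h3 : 0 ≤ 4 * (n + 2) * ((p + 1) * ((n + 2) - (n - 2) * p)) := by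
          nlinarith [sq_nonneg (2 * (2 * p + 2 - n * q))]
        exact nonneg_of_mul_nonneg_right h3 (by linarith)
  have e : (n + 2) * ((1 + x) * (p + 1) / (q + 1) - 1) ^ 2 -
      2 * n * (((1 + x) * (p + 1) / (q + 1) / (p + 1) - 1 / (q + 1)) *
        (p * ((1 + x) * (p + 1) / (q + 1)) - q)) =
      (((p + 1) * ((n + 2) - (n - 2) * p)) * x ^ 2 +
      (2 * (2 * p + 2 - n * q)) * (p - q) * x + (n + 2) * (p - q) ^ 2) / (q + 1) ^ 2 := by
    field_simp
    ring
  have : 0 ≤ (((p + 1) * ((n + 2) - (n - 2) * p)) * x ^ 2 +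
      (2 * (2 * p + 2 - n * q)) * (p - q) * x + (n + 2) * (p - q) ^ 2) / (q + 1) ^ 2 := by
    positivity
  linarith

lemma conv_D {n p q p1 : ℝ} (hn : 2 ≤ n) (h1 : q < p) (h2 : p ≤ p1)
    (d1 : n * (q + q + 1) ^ 2 ≤ 2 * (n + 2) * (q + 1) * (q + 1))
    (d2 : n * (p1 + q + 1) ^ 2 ≤ 2 * (n + 2) * (p1 + 1) * (q + 1)) :
    n * (p + q + 1) ^ 2 ≤ 2 * (n + 2) * (p + 1) * (q + 1) := by
  have e : (p1 - q) * (2 * (n + 2) * (p + 1) * (q + 1) - n * (p + q + 1) ^ 2) =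
    (p1 - p) * (2 * (n + 2) * (q + 1) * (q + 1) - n * (q + q + 1) ^ 2) +
    (p - q) * (2 * (n + 2) * (p1 + 1) * (q + 1) - n * (p1 + q + 1) ^ 2) +
    n * ((p - q) * (p1 - p) * (p1 - q)) := by ring
  have a1 := mul_nonneg (sub_nonneg.2 h2) (sub_nonneg.2 d1)
  have a2 := mul_nonneg (sub_nonneg.2 h1.le) (sub_nonneg.2 d2)
  have a3 : 0 ≤ n * ((p - q) * (p1 - p) * (p1 - q)) := by
    have b1 := sub_nonneg.2 h1.le
    have b2 := sub_nonneg.2 h2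
    have b3 : 0 ≤ p1 - q := by linarith
    have b4 : 0 ≤ n := by linarith
    positivity
  have := nonneg_of_mul_nonneg_right (by rw [e]; linarith : 0 ≤ (p1 - q) *
    (2 * (n + 2) * (p + 1) * (q + 1) - n * (p + q + 1) ^ 2)) (by linarith)
  linarith

lemma cond_poly {n : ℕ} (hn : 2 ≤ n) {p q : ℝ} (hq : 0 < q) (hqp : q < p)
    (hcond :
      (2 < n ∧ q ≤ 4 / ((n : ℝ) - 2) ∧ p ≤ ((n : ℝ) + 2) / ((n : ℝ) - 2)) ∨
      (2 < n ∧ 4 / ((n : ℝ) - 2) < q ∧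
        q < (4 + Real.sqrt (2 * (n : ℝ) * ((n : ℝ) + 2))) / (2 * ((n : ℝ) - 2)) ∧
        p ≤ (2 * (q + 1) +
          Real.sqrt (((n : ℝ) + 2) * (q + 1) * ((n : ℝ) + 2 - ((n : ℝ) - 2) * q))) / (n : ℝ)) ∨
      (n = 2)) :
    (((n:ℝ) - 2) * p ≤ n + 2 ∧ n * q ≤ 2 * p + 2) ∨
      n * (p + q + 1) ^ 2 ≤ 2 * ((n:ℝ) + 2) * (p + 1) * (q + 1) := by
  have hn2 : (2:ℝ) ≤ n := by exact_mod_cast hn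
  rcases hcond with ⟨h2, hq1, hp1⟩ | ⟨h2, hq1, hq2, hp1⟩ | rfl
  · have h2 : (2:ℝ) < n := by exact_mod_cast h2
    have hm : 0 < (n:ℝ) - 2 := by linarith
    rw [le_div_iff₀ hm] at hq1 hp1
    rcases le_or_gt ((n:ℝ) * q) (2 * p + 2) with h | h
    · left; exact ⟨by linarith, h⟩
    · right
      refine conv_D hn2 hqp (p1 := ((n:ℝ) * q - 2) / 2) (by linarith) ?_ ?_
      · nlinarith [mul_nonneg hq.le (by linarith : 0 ≤ 4 - q * ((n:ℝ) - 2))]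
      · have : 0 ≤ (n:ℝ) * (n + 2) * q / 4 * (4 - q * ((n:ℝ) - 2)) :=
          mul_nonneg (by positivity) (by linarith)
        nlinarith
  · have h2 : (2:ℝ) < n := by exact_mod_cast h2
    have hm : 0 < (n:ℝ) - 2 := by linarith
    have hn0 : 0 < (n:ℝ) := by linarith
    rw [div_lt_iff₀ hm] at hq1
    rw [lt_div_iff₀ (by linarith)] at hq2
    right
    have hs : Real.sqrt (2 * (n : ℝ) * ((n : ℝ) + 2)) ^ 2 = 2 * (n : ℝ) * ((n : ℝ) + 2) :=
      Real.sq_sqrt (by positivity)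
    set S := Real.sqrt (2 * (n : ℝ) * ((n : ℝ) + 2)) with hS
    have hS0 : 0 ≤ S := Real.sqrt_nonneg _
    have hSn : S ≤ 2 * n := by
      refine (abs_le_of_sq_le_sq' ?_ (by linarith)).2
      rw [hs]; nlinarith
    have y0 : 0 < 2 * ((n:ℝ) - 2) * q - 4 := by nlinarith
    have yS : 2 * ((n:ℝ) - 2) * q - 4 < S := by linarith
    have y2 : (2 * ((n:ℝ) - 2) * q - 4) ^ 2 < 2 * (n : ℝ) * ((n : ℝ) + 2) := by
      rw [← hs]; exact pow_lt_pow_left₀ yS y0.le two_ne_zero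
    have hR0 : 0 ≤ (n : ℝ) + 2 - ((n : ℝ) - 2) * q := by nlinarith
    have hr : Real.sqrt (((n : ℝ) + 2) * (q + 1) * ((n : ℝ) + 2 - ((n : ℝ) - 2) * q)) ^ 2 =
        ((n : ℝ) + 2) * (q + 1) * ((n : ℝ) + 2 - ((n : ℝ) - 2) * q) :=
      Real.sq_sqrt (by positivity)
    set Q := Real.sqrt (((n : ℝ) + 2) * (q + 1) * ((n : ℝ) + 2 - ((n : ℝ) - 2) * q)) with hQ
    refine conv_D hn2 hqp hp1 ?_ ?_
    · have : 0 ≤ (2 * ((n:ℝ) - 2)) * (2 * ((n:ℝ) + 2) * (q + 1) * (q + 1) - n * (q + q + 1) ^ 2) := by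
        nlinarith
      have := nonneg_of_mul_nonneg_right this (by linarith)
      linarith
    · have : (n:ℝ) * (2 * ((n:ℝ) + 2) * ((2 * (q + 1) + Q) / n + 1) * (q + 1) -
          n * ((2 * (q + 1) + Q) / n + q + 1) ^ 2) =
          ((n : ℝ) + 2) * (q + 1) * ((n : ℝ) + 2 - ((n : ℝ) - 2) * q) - Q ^ 2 := by
        field_simp
        ring
      rw [hr, sub_self] at this
      have := (mul_eq_zero.1 this).resolve_left hn0.ne'
      linarith
  · left
    push_cast
    constructor <;> linarith

section conc
variable {p q : ℝ}

lemma pw_split {s : ℝ} (hs : 0 < s) (x y : ℝ) : s ^ (x + y) = s ^ x * s ^ y := Real.rpow_add hs x y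

lemma conc_Nl {k : ℕ} (hk : 1 ≤ k) (hq : 0 < q) (hqp : q < p)
    (hc : ((((k + 1 : ℕ):ℝ) - 2) * p ≤ ((k + 1 : ℕ):ℝ) + 2 ∧ ((k + 1 : ℕ):ℝ) * q ≤ 2 * p + 2) ∨
      ((k + 1 : ℕ):ℝ) * (p + q + 1) ^ 2 ≤ 2 * (((k + 1 : ℕ):ℝ) + 2) * (p + 1) * (q + 1)) :
    Nl k (fun s => s ^ p - s ^ q) (fun s => s ^ (p + 1) / (p + 1) - s ^ (q + 1) / (q + 1))
      (fun s => ((s ^ p - s ^ q) * (s ^ p - s ^ q) -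
        (s ^ (p + 1) / (p + 1) - s ^ (q + 1) / (q + 1)) * (p * s ^ (p - 1) - q * s ^ (q - 1))) /
        (s ^ p - s ^ q) ^ 2)
      (((p + 1) / (q + 1)) ^ (1 / (p - q))) := by
  have hp : 0 < p := hq.trans hqp
  have hd : 0 < p - q := by linarith
  set tb := (p + 1) / (q + 1) with htb
  have htb1 : 1 < tb := by rw [htb, one_lt_div (by linarith)]; linarith
  set β := tb ^ (1 / (p - q)) with hβ
  have hβ1 : 1 < β := Real.one_lt_rpow htb1 (by positivity)
  have hβt : β ^ (p - q) = tb := by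
    rw [hβ, ← Real.rpow_mul (by linarith), one_div, inv_mul_cancel₀ hd.ne', Real.rpow_one]
  have fe : ∀ s : ℝ, 0 < s → s ^ p - s ^ q = s ^ q * (s ^ (p - q) - 1) := by
    intro s hs
    rw [mul_sub, ← Real.rpow_add hs, mul_one]; congr 2; ring
  have Fe : ∀ s : ℝ, 0 < s → s ^ (p + 1) / (p + 1) - s ^ (q + 1) / (q + 1) =
      s ^ (q + 1) * (s ^ (p - q) / (p + 1) - 1 / (q + 1)) := by
    intro s hs
    have : s ^ (p + 1) = s ^ (q + 1) * s ^ (p - q) := by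
      rw [← Real.rpow_add hs]; congr 1; ring
    rw [this]; ring
  have tfac : ∀ t : ℝ, t / (p + 1) - 1 / (q + 1) = (t - tb) / (p + 1) := by
    intro t; rw [htb]; field_simp
  have tmono : ∀ s : ℝ, β < s → tb < s ^ (p - q) := by
    intro s hs; rw [← hβt]; exact Real.rpow_lt_rpow (by linarith) hs hd
  have tmono' : ∀ s : ℝ, β ≤ s → tb ≤ s ^ (p - q) := by
    intro s hs; rw [← hβt]; exact Real.rpow_le_rpow (by linarith) hs hd.le
  have tmono2 : ∀ s : ℝ, 0 ≤ s → s ≤ β → s ^ (p - q) ≤ tb := by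
    intro s h0 hs; rw [← hβt]; exact Real.rpow_le_rpow h0 hs hd.le
  have fpos : ∀ s : ℝ, β ≤ s → 0 < s ^ p - s ^ q := by
    intro s hs
    have hs0 : 0 < s := by linarith
    rw [fe s hs0]
    have := tmono' s hs
    exact mul_pos (Real.rpow_pos_of_pos hs0 _) (by linarith)
  have dF : ∀ s : ℝ, 0 < s → HasDerivAt
      (fun s : ℝ => s ^ (p + 1) / (p + 1) - s ^ (q + 1) / (q + 1)) (s ^ p - s ^ q) s := by
    intro s hs
    have h1 := ((Real.hasDerivAt_rpow_const (x := s) (p := p + 1) (Or.inl hs.ne')).div_const (p + 1))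
    have h2 := ((Real.hasDerivAt_rpow_const (x := s) (p := q + 1) (Or.inl hs.ne')).div_const (q + 1))
    refine (h1.sub h2).congr_deriv ?_
    rw [add_sub_cancel_right, add_sub_cancel_right]
    field_simp
  refine ⟨hk, hβ1, ?_, ?_, dF, ?_, ?_, ?_, ?_, fpos, ?_, ?_⟩
  · exact ((continuousOn_id.rpow_const (fun _ _ => Or.inr (by linarith))).div_const _).sub
      ((continuousOn_id.rpow_const (fun _ _ => Or.inr (by linarith))).div_const _)
  · exact (continuousOn_id.rpow_const (fun _ _ => Or.inr (by linarith))).sub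
      (continuousOn_id.rpow_const (fun _ _ => Or.inr (by linarith)))
  · rw [Real.zero_rpow (by linarith), Real.zero_rpow (by linarith)]; simp
  · rw [Fe β (by linarith), tfac, hβt]; simp
  · intro s hs
    rcases eq_or_lt_of_le hs.1 with h | h
    · rw [← h, Real.zero_rpow (by linarith), Real.zero_rpow (by linarith)]; simp
    · rw [Fe s h, tfac]
      have := tmono2 s hs.1 hs.2
      exact mul_nonpos_of_nonneg_of_nonpos (Real.rpow_nonneg hs.1 _)
        (div_nonpos_of_nonpos_of_nonneg (by linarith) (by linarith))
  · intro s hs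
    have hs0 : 0 < s := by linarith
    rw [Fe s hs0, tfac]
    have := tmono s hs
    exact mul_pos (Real.rpow_pos_of_pos hs0 _) (div_pos (by linarith) (by linarith))
  · intro s hs
    have hs0 : 0 < s := by linarith
    exact (dF s hs0).div ((Real.hasDerivAt_rpow_const (Or.inl hs0.ne')).sub
      (Real.hasDerivAt_rpow_const (Or.inl hs0.ne'))) (fpos s hs.le).ne'
  · intro s hs
    have hs0 : 0 < s := by linarith
    have ff := fpos s hs.le
    have hk1 : (1:ℝ) ≤ k := by exact_mod_cast hk
    have hn2 : (2:ℝ) ≤ ((k + 1 : ℕ):ℝ) := by push_cast; linarith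
    have key := poly_ineq hn2 hq hqp (tmono s hs).le hc
    have e1 : (s ^ (p + 1) / (p + 1) - s ^ (q + 1) / (q + 1)) * (p * s ^ (p - 1) - q * s ^ (q - 1))
        = (s ^ q) ^ 2 * ((s ^ (p - q) / (p + 1) - 1 / (q + 1)) * (p * s ^ (p - q) - q)) := by
      rw [Fe s hs0]
      have a1 : s ^ (q + 1) = s ^ q * s := by rw [Real.rpow_add hs0, Real.rpow_one]
      have a2 : s * (p * s ^ (p - 1) - q * s ^ (q - 1)) = s ^ q * (p * s ^ (p - q) - q) := by
        have b1 : s * s ^ (p - 1) = s ^ q * s ^ (p - q) := by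
          rw [← Real.rpow_add hs0]
          nth_rewrite 1 [← Real.rpow_one s]
          rw [← Real.rpow_add hs0]; congr 1; ring
        have b2 : s * s ^ (q - 1) = s ^ q := by
          nth_rewrite 1 [← Real.rpow_one s]
          rw [← Real.rpow_add hs0]; congr 1; ring
        calc s * (p * s ^ (p - 1) - q * s ^ (q - 1)) = p * (s * s ^ (p - 1)) - q * (s * s ^ (q-1)) := by
              ring
          _ = _ := by rw [b1, b2]; ring
      rw [a1]
      linear_combination (s ^ q * (s ^ (p - q) / (p + 1) - 1 / (q + 1))) * a2
    rw [e1, ← mul_div_assoc, le_div_iff₀ (by positivity), fe s hs0]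
    have hsq : 0 ≤ (s ^ q) ^ 2 := sq_nonneg _
    have := mul_le_mul_of_nonneg_left key hsq
    push_cast at this
    generalize (s ^ (p - q) / (p + 1) - 1 / (q + 1)) * (p * s ^ (p - q) - q) = G at *
    generalize s ^ (p - q) = t at *
    generalize s ^ q = y at *
    nlinarith

lemma conc_lip (hq : 1 ≤ q) (hqp : q < p) : ∀ C : ℝ, ∃ L : ℝ, 0 ≤ L ∧ ∀ s ∈ Icc 0 C, ∀ t ∈ Icc 0 C,
      |(fun s : ℝ => s ^ p - s ^ q) s - (fun s : ℝ => s ^ p - s ^ q) t| ≤ L * |s - t| := by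
  intro C
  have hc : ContinuousOn (fun s : ℝ => p * s ^ (p - 1) - q * s ^ (q - 1)) (Icc 0 C) :=
    (continuousOn_const.mul (continuousOn_id.rpow_const (fun _ _ => Or.inr (by linarith)))).sub
      (continuousOn_const.mul (continuousOn_id.rpow_const (fun _ _ => Or.inr (by linarith))))
  obtain ⟨L, hL⟩ := isCompact_Icc.exists_bound_of_continuousOn hc
  refine ⟨max L 0, le_max_right _ _, ?_⟩
  intro s hs t ht
  have := (convex_Icc (0:ℝ) C).norm_image_sub_le_of_norm_hasDerivWithin_le
    (f := fun s : ℝ => s ^ p - s ^ q) (f' := fun s => p * s ^ (p - 1) - q * s ^ (q - 1))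
    (C := max L 0)
    (fun x _ => ((Real.hasDerivAt_rpow_const (Or.inr (by linarith))).sub
      (Real.hasDerivAt_rpow_const (Or.inr hq))).hasDerivWithinAt)
    (fun x hx => (hL x hx).trans (le_max_left _ _)) ht hs
  exact this

lemma conc_sup (hq : 1 ≤ q) (hqp : q < p) : ∀ s t : ℝ, 1 ≤ s → s < t →
    (t - 1) * (fun s : ℝ => s ^ p - s ^ q) s ≤ (s - 1) * (fun s : ℝ => s ^ p - s ^ q) t := by
  have hd : ∀ x : ℝ, HasDerivAt (fun s : ℝ => s ^ p - s ^ q) (p * x ^ (p - 1) - q * x ^ (q - 1)) x :=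
    fun x => (Real.hasDerivAt_rpow_const (Or.inr (by linarith))).sub
      (Real.hasDerivAt_rpow_const (Or.inr hq))
  have hconv : ConvexOn ℝ (Ici (1:ℝ)) (fun s : ℝ => s ^ p - s ^ q) := by
    apply MonotoneOn.convexOn_of_deriv (convex_Ici 1)
    · exact fun x _ => (hd x).continuousAt.continuousWithinAt
    · exact fun x _ => (hd x).differentiableAt.differentiableWithinAt
    · rw [interior_Ici]
      intro x hx y hy hxy
      have hx : 1 < x := hx
      have hy : 1 < y := hy
      rw [(hd x).deriv, (hd y).deriv]
      have e : ∀ z : ℝ, 1 < z → p * z ^ (p - 1) - q * z ^ (q - 1) =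
          z ^ (q - 1) * (p * z ^ (p - q) - q) := by
        intro z hz
        have : z ^ (p - 1) = z ^ (q - 1) * z ^ (p - q) := by
          rw [← Real.rpow_add (by linarith)]; congr 1; ring
        rw [this]; ring
      rw [e x hx, e y hy]
      have a1 : x ^ (q - 1) ≤ y ^ (q - 1) := Real.rpow_le_rpow (by linarith) hxy (by linarith)
      have a2 : x ^ (p - q) ≤ y ^ (p - q) := Real.rpow_le_rpow (by linarith) hxy (by linarith)
      have a3 : 1 ≤ x ^ (p - q) := Real.one_le_rpow hx.le (by linarith)
      have a4 : 0 ≤ y ^ (q - 1) := Real.rpow_nonneg (by linarith) _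
      apply mul_le_mul a1 _ _ a4
      · have := mul_le_mul_of_nonneg_left a2 (by linarith : 0 ≤ p)
        linarith
      · nlinarith
  intro s t hs hst
  have h1 : 0 < t - 1 := by linarith
  have := hconv.2 (show (1:ℝ) ∈ Ici (1:ℝ) by simp) (show t ∈ Ici (1:ℝ) from by simp; linarith)
    (show 0 ≤ 1 - (s - 1) / (t - 1) by rw [sub_nonneg, div_le_one h1]; linarith)
    (show 0 ≤ (s - 1) / (t - 1) by apply div_nonneg <;> linarith) (by ring)
  have e : (1 - (s - 1) / (t - 1)) • (1:ℝ) + ((s - 1) / (t - 1)) • t = s := by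
    simp only [smul_eq_mul]; field_simp; ring
  rw [e] at this
  simp only [smul_eq_mul, Real.one_rpow, sub_self, mul_zero, zero_add] at this
  simp only
  calc (t - 1) * (s ^ p - s ^ q) ≤ (t - 1) * ((s - 1) / (t - 1) * (t ^ p - t ^ q)) := by gcongr
    _ = _ := by field_simp

lemma conc_q {k : ℕ} {m' : ℝ → ℝ} {β a : ℝ} {u w : ℝ → ℝ} (hq : 0 < q) (hqp : q < p)
    (N : Nl k (fun s => s ^ p - s ^ q)
      (fun s => s ^ (p + 1) / (p + 1) - s ^ (q + 1) / (q + 1)) m' β)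
    (h : Sol k (fun s => s ^ p - s ^ q) a u w) : 1 ≤ q := by
  by_contra hcon
  push Not at hcon
  obtain ⟨T, haT, hT, -, hn⟩ := h.turn N
  obtain ⟨R, hR1, hR2⟩ := (eventually_atTop.1 (h.lim.eventually (gt_mem_nhds zero_lt_one))).imp
    (fun R hR => (⟨hR, rfl⟩ : (∀ b ≥ R, u b < 1) ∧ R = R))
  set R₀ := max R (T + 1) with hR₀
  have hlow : ∀ r, R₀ ≤ r → a < r ∧ w r < 0 ∧ u r < 1 ∧ 0 < u r := by
    intro r hr
    have x1 : R ≤ r := (le_max_left _ _).trans hr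
    have x2 : T + 1 ≤ r := (le_max_right _ _).trans hr
    exact ⟨by linarith, hn r (by linarith), hR1 r x1, h.upos r (by linarith)⟩
  set c := 2 * (1 / (q + 1) - 1 / (p + 1)) with hc
  have hc0 : 0 < c := by
    have : 1 / (p + 1) < 1 / (q + 1) := one_div_lt_one_div_of_lt (by linarith) (by linarith)
    rw [hc]; linarith
  set κ := (1 - q) / 2 * Real.sqrt c with hκ
  have hκ0 : 0 < κ := mul_pos (by linarith) (Real.sqrt_pos.2 hc0)
  have hw : ∀ r, R₀ ≤ r → Real.sqrt c * u r ^ ((q + 1) / 2) ≤ - w r := by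
    intro r hr
    obtain ⟨x1, x2, x3, x4⟩ := hlow r hr
    have hE := h.Epos N x1.le
    refine (abs_le_of_sq_le_sq' ?_ (by linarith)).2
    rw [mul_pow, Real.sq_sqrt hc0.le, ← Real.rpow_natCast, ← Real.rpow_mul x4.le]
    have e : (q + 1) / 2 * ((2:ℕ):ℝ) = q + 1 := by push_cast; ring
    rw [e]
    have : u r ^ (p + 1) ≤ u r ^ (q + 1) :=
      Real.rpow_le_rpow_of_exponent_ge x4 x3.le (by linarith)
    have h3 : u r ^ (p + 1) / (p + 1) ≤ u r ^ (q + 1) / (p + 1) := by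
      have : 0 < p + 1 := by linarith
      gcongr
    rw [neg_sq, hc]
    have e4 : 2 * (1 / (q + 1) - 1 / (p + 1)) * u r ^ (q + 1) =
      2 * (u r ^ (q + 1) / (q + 1)) - 2 * (u r ^ (q + 1) / (p + 1)) := by ring
    rw [e4]
    linarith
  have hdec : ∀ r, R₀ ≤ r → u r ^ ((1 - q) / 2) + κ * r ≤ u R₀ ^ ((1 - q) / 2) + κ * R₀ := by
    intro r hr
    refine ax_anti (g := fun r => u r ^ ((1 - q) / 2) + κ * r)
      (g' := fun r => w r * ((1 - q) / 2) * u r ^ ((1 - q) / 2 - 1) + κ * 1) hr ?_ ?_ ?_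
    · refine ContinuousOn.add (ContinuousOn.rpow_const (h.cu.mono ?_) ?_) (by fun_prop)
      · exact fun x hx => (hlow x hx.1).1.le
      · exact fun x hx => Or.inl (hlow x hx.1).2.2.2.ne'
    · intro x hx
      obtain ⟨x1, x2, x3, x4⟩ := hlow x hx.1.le
      exact ((h.du x x1).rpow_const (Or.inl x4.ne')).add ((hasDerivAt_id x).const_mul κ)
    · intro x hx
      obtain ⟨x1, x2, x3, x4⟩ := hlow x hx.1.le
      have h1 := hw x hx.1.le
      have h2 : u x ^ ((q + 1) / 2) * u x ^ ((1 - q) / 2 - 1) = 1 := by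
        rw [← Real.rpow_add x4]
        have : (q + 1) / 2 + ((1 - q) / 2 - 1) = 0 := by ring
        rw [this, Real.rpow_zero]
      have h3 : 0 ≤ (1 - q) / 2 * u x ^ ((1 - q) / 2 - 1) :=
        mul_nonneg (by linarith) (Real.rpow_nonneg x4.le _)
      have h4 := mul_le_mul_of_nonneg_right h1 h3
      have h5 : Real.sqrt c * u x ^ ((q + 1) / 2) * ((1 - q) / 2 * u x ^ ((1 - q) / 2 - 1)) = κ := by
        rw [hκ]; linear_combination (Real.sqrt c * ((1 - q) / 2)) * h2
      rw [h5] at h4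
      linarith
  set G := u R₀ ^ ((1 - q) / 2) with hG
  have hG0 : 0 ≤ G := Real.rpow_nonneg (hlow R₀ le_rfl).2.2.2.le _
  have hr : R₀ ≤ R₀ + (G + 1) / κ := by
    have : 0 ≤ (G + 1) / κ := by positivity
    linarith
  have := hdec _ hr
  have h0 := Real.rpow_nonneg (hlow _ hr).2.2.2.le ((1 - q) / 2)
  have e : κ * (R₀ + (G + 1) / κ) = κ * R₀ + G + 1 := by field_simp; ring
  linarith

end conc

end partG

lemma ext_sol {k : ℕ} {f u w : ℝ → ℝ} {a : ℝ} (ha : 0 < a) (hf : Continuous f)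
    (h : IsPosSolExt (k + 1) a f u w) : Sol k f a u w := by
  obtain ⟨cu, dwu, du, dw, ua, up, lim⟩ := h
  have hk : (((k + 1 : ℕ) : ℝ) - 1) = k := by push_cast; ring
  rw [hk] at dw
  set g : ℝ → ℝ := fun t => t ^ k * f (u (max t a)) with hg
  have cg : Continuous g := by
    refine (continuous_pow k).mul (hf.comp ?_)
    exact cu.comp_continuous (continuous_id.max continuous_const) (fun x => mem_Ici.2 (le_max_right x a))
  set G : ℝ → ℝ := fun r => ∫ t in a..r, g t with hG
  have dG : ∀ r, HasDerivAt G (g r) r := fun r =>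
    intervalIntegral.integral_hasDerivAt_right (cg.intervalIntegrable _ _)
      (cg.stronglyMeasurableAtFilter _ _) cg.continuousAt
  have dH : ∀ r, a < r → HasDerivAt (fun r => r ^ k * w r + G r) 0 r := by
    intro r hr
    have hr0 : 0 < r := ha.trans hr
    have := ((hasDerivAt_pow k r).mul (dw r hr)).add (dG r)
    refine this.congr_deriv ?_
    simp only [hg, max_eq_left hr.le]
    rcases Nat.eq_zero_or_pos k with h0 | h0
    · subst h0; simp
    · obtain ⟨j, rfl⟩ : ∃ j, k = j + 1 := ⟨k - 1, by lia⟩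
      simp only [Nat.add_sub_cancel]
      field_simp
      ring
  set c := (a + 1) ^ k * w (a + 1) + G (a + 1) with hc
  have hconst : ∀ r, a < r → r ^ k * w r + G r = c := by
    intro r hr
    have key : ∀ x y, a < x → x ≤ y → x ^ k * w x + G x = y ^ k * w y + G y := by
      intro x y hx hxy
      have cc : ContinuousOn (fun r => r ^ k * w r + G r) (Icc x y) := fun z hz =>
        (dH z (hx.trans_le hz.1)).continuousAt.continuousWithinAt
      exact le_antisymm
        (ax_mono (g' := fun _ => 0) hxy cc (fun z hz => dH z (hx.trans hz.1)) (fun _ _ => le_rfl))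
        (ax_anti (g' := fun _ => 0) hxy cc (fun z hz => dH z (hx.trans hz.1)) (fun _ _ => le_rfl))
    rcases le_total r (a + 1) with h | h
    · exact key r (a + 1) hr h
    · exact (key (a + 1) r (by linarith) h).symm
  have hw : ∀ r, a < r → w r = (c - G r) / r ^ k := by
    intro r hr
    have hr0 : 0 < r := ha.trans hr
    rw [eq_div_iff (by positivity), ← hconst r hr]; ring
  have hlim : Tendsto w (nhdsWithin a (Ioi a)) (nhds ((c - G a) / a ^ k)) := by
    have h1 : ContinuousAt (fun r => (c - G r) / r ^ k) a :=
      (continuousAt_const.sub (dG a).continuousAt).div (continuousAt_id.pow k) (by positivity)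
    refine (h1.tendsto.mono_left nhdsWithin_le_nhds).congr' ?_
    filter_upwards [self_mem_nhdsWithin] with r hr
    exact (hw r hr).symm
  have hd : HasDerivWithinAt u ((c - G a) / a ^ k) (Ici a) a := by
    refine hasDerivWithinAt_Ici_of_tendsto_deriv (s := Ioi a) ?_ ?_ self_mem_nhdsWithin ?_
    · exact fun x hx => (du x hx).differentiableAt.differentiableWithinAt
    · exact (cu a self_mem_Ici).mono Ioi_subset_Ici_self
    · refine hlim.congr' ?_
      filter_upwards [self_mem_nhdsWithin] with r hr
      exact (du r hr).deriv.symm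
  have hwa : w a = (c - G a) / a ^ k :=
    (uniqueDiffWithinAt_Ici a).eq_deriv _ (dwu a self_mem_Ici) hd
  refine ⟨ha, cu, ?_, du, dw, ua, up, lim⟩
  intro r hr
  rcases eq_or_lt_of_le (show a ≤ r from hr) with e | e
  · subst e
    rw [← continuousWithinAt_Ioi_iff_Ici]
    show Tendsto w _ _
    rw [hwa]; exact hlim
  · exact (dw r e).continuousAt.continuousWithinAt

/-- Corollary 2 (exterior part): for `f(s) = s^p - s^q` with `p > q > 0`, under any of the
conditions (i)–(iii), the exterior problem (R) with `b = ∞` has at most one positive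
solution for every `a ∈ (0,∞)`. -/
theorem uniqueness_exterior_diff_powers
    (n : ℕ) (hn : 2 ≤ n) (p q : ℝ) (hq : 0 < q) (hqp : q < p)
    (hcond :
      (2 < n ∧ q ≤ 4 / ((n : ℝ) - 2) ∧ p ≤ ((n : ℝ) + 2) / ((n : ℝ) - 2)) ∨
      (2 < n ∧ 4 / ((n : ℝ) - 2) < q ∧
        q < (4 + Real.sqrt (2 * (n : ℝ) * ((n : ℝ) + 2))) / (2 * ((n : ℝ) - 2)) ∧
        p ≤ (2 * (q + 1) +
          Real.sqrt (((n : ℝ) + 2) * (q + 1) * ((n : ℝ) + 2 - ((n : ℝ) - 2) * q))) / (n : ℝ)) ∨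
      (n = 2))
    (a : ℝ) (ha : 0 < a)
    (u₁ u₁' u₂ u₂' : ℝ → ℝ)
    (h₁ : IsPosSolExt n a (fun s => s ^ p - s ^ q) u₁ u₁')
    (h₂ : IsPosSolExt n a (fun s => s ^ p - s ^ q) u₂ u₂') :
    ∀ r ∈ Ici a, u₁ r = u₂ r := by
  obtain ⟨k, rfl⟩ : ∃ k, n = k + 1 := ⟨n - 1, by lia⟩
  have hf : Continuous (fun s : ℝ => s ^ p - s ^ q) :=
    (Real.continuous_rpow_const (by linarith)).sub (Real.continuous_rpow_const (by linarith))
  have N := conc_Nl (k := k) (by lia) hq hqp (cond_poly hn hq hqp hcond)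
  have s₁ := ext_sol ha hf h₁
  have s₂ := ext_sol ha hf h₂
  have hq1 := conc_q hq hqp N s₁
  exact fun r hr => abs_unique N (conc_lip hq1 hqp) (conc_sup hq1 hqp) s₁ s₂ r hr
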